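/- For every integer k ≥ 1, every graph G of order at least 3k with σ₂(G) ≥ 6k − 1 contains k pairwise vertex-disjoint cycles, each of length divisible by 3. -/

import Mathlib

namespace ModThree

set_option linter.unusedSectionVars false

variable {V : Type*} [DecidableEq V] {G : SimpleGraph V}

/-- `PathOn G S u v n`: there is a path from `u` to `v` in `G` of length `n` whose vertex set is
exactly `S`. -/
inductive PathOn (G : SimpleGraph V) : Finset V → V → V → ℕ → Prop
  | nil (u : V) : PathOn G {u} u u 0
  | cons {S : Finset V} {u w v : V} {n : ℕ} : G.Adj u w → u ∉ S → PathOn G S w v n →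
      PathOn G (insert u S) u v (n + 1)

/-- The vertex set `S` contains a cycle of `G` whose length is divisible by three. -/
def HasCycle (G : SimpleGraph V) (S : Finset V) : Prop :=
  ∃ S₀ ⊆ S, ∃ u v n, PathOn G S₀ u v n ∧ 2 ≤ n ∧ G.Adj v u ∧ 3 ∣ n + 1

/-- Any two vertices of `T` are joined by a path inside `T`. -/
def Conn (G : SimpleGraph V) (T : Finset V) : Prop :=
  ∀ u ∈ T, ∀ v ∈ T, ∃ S ⊆ T, ∃ n, PathOn G S u v n

namespace PathOn

theorem left_mem {S : Finset V} {u v : V} {n : ℕ} (h : PathOn G S u v n) : u ∈ S := by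
  cases h <;> simp

theorem right_mem {S : Finset V} {u v : V} {n : ℕ} (h : PathOn G S u v n) : v ∈ S := by
  induction h with
  | nil u => simp
  | cons _ _ _ ih => exact Finset.mem_insert_of_mem ih

theorem card_eq {S : Finset V} {u v : V} {n : ℕ} (h : PathOn G S u v n) : S.card = n + 1 := by
  induction h with
  | nil u => simp
  | cons _ hu _ ih => rw [Finset.card_insert_of_notMem hu, ih]

theorem append {S S' : Finset V} {u v w : V} {n m : ℕ} (h : PathOn G S u v n)
    (h' : PathOn G S' v w m) (hS : ∀ z ∈ S, z ∈ S' → z = v) : PathOn G (S ∪ S') u w (n + m) := by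
  induction h with
  | nil u =>
    have := h'.left_mem
    rw [Finset.union_eq_right.2 (by simpa using this)]
    simpa using h'
  | @cons S u x v n hux hu hp ih =>
    have h1 : u ∉ S' := fun hu' => by
      have := hS u (by simp) hu'
      exact hu (this ▸ hp.right_mem)
    rw [Finset.insert_union, show n + 1 + m = n + m + 1 by omega]
    exact .cons hux (by simp [hu, h1]) (ih h' fun z hz => hS z (Finset.mem_insert_of_mem hz))

theorem of_adj {u v : V} (h : G.Adj u v) : PathOn G {u, v} u v 1 :=
  .cons h (by simpa using h.ne) (.nil v)

theorem link {S S' : Finset V} {u v v' w : V} {n m : ℕ} (h : PathOn G S u v n)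
    (ha : G.Adj v v') (h' : PathOn G S' v' w m) (hS : Disjoint S S') :
    PathOn G (S ∪ S') u w (n + m + 1) := by
  have hv : v ∉ S' := Finset.disjoint_left.1 hS h.right_mem
  have := h.append (.cons ha hv h') (by
    intro z hz hz'
    rcases Finset.mem_insert.1 hz' with rfl | hz'
    · rfl
    · exact absurd hz' (Finset.disjoint_left.1 hS hz))
  rwa [Finset.union_insert, Finset.insert_eq_of_mem (Finset.mem_union_left _ h.right_mem)] at this

theorem symm {S : Finset V} {u v : V} {n : ℕ} (h : PathOn G S u v n) : PathOn G S v u n := by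
  induction h with
  | nil u => exact .nil u
  | @cons S u w v n hux hu hp ih =>
    have := ih.link hux.symm (.nil u) (by simpa using hu)
    rwa [Finset.union_comm, ← Finset.insert_eq] at this

theorem split {S : Finset V} {u v : V} {n : ℕ} (h : PathOn G S u v n) {z : V} (hz : z ∈ S) :
    ∃ S₁ S₂ a b, PathOn G S₁ u z a ∧ PathOn G S₂ z v b ∧ S₁ ∪ S₂ = S ∧
      (∀ y ∈ S₁, y ∈ S₂ → y = z) ∧ a + b = n := by
  induction h with
  | nil u =>
    obtain rfl := Finset.mem_singleton.1 hz
    exact ⟨{z}, {z}, 0, 0, .nil z, .nil z, by simp, by simp, rfl⟩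
  | @cons S u x v n hux hu hp ih =>
    by_cases hzu : z = u
    · subst hzu
      refine ⟨{z}, _, 0, n + 1, .nil z, .cons hux hu hp, by simp, by simp, by simp⟩
    · obtain ⟨S₁, S₂, a, b, h1, h2, h3, h4, h5⟩ :=
        ih ((Finset.mem_insert.1 hz).resolve_left hzu)
      refine ⟨insert u S₁, S₂, a + 1, b, .cons hux ?_ h1, h2, ?_, ?_, by omega⟩
      · exact fun h => hu (h3 ▸ Finset.mem_union_left _ h)
      · rw [Finset.insert_union, h3]
      · intro y hy hy2
        rcases Finset.mem_insert.1 hy with rfl | hy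
        · exact absurd (h3 ▸ Finset.mem_union_right _ hy2) hu
        · exact h4 y hy hy2

theorem mono {G' : SimpleGraph V} {S : Finset V} {u v : V} {n : ℕ} (h : PathOn G S u v n)
    (hG : ∀ a ∈ S, ∀ b ∈ S, G.Adj a b → G'.Adj a b) : PathOn G' S u v n := by
  induction h with
  | nil u => exact .nil u
  | @cons S u x v n hux hu hp ih =>
    exact .cons (hG _ (by simp) _ (by simp [hp.left_mem]) hux) hu
      (ih fun a ha b hb => hG a (by simp [ha]) b (by simp [hb]))

theorem eq_of_length_zero {S : Finset V} {u v : V} (h : PathOn G S u v 0) : u = v ∧ S = {u} := by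
  cases h; simp

theorem ne_of_pos {S : Finset V} {u v : V} {n : ℕ} (h : PathOn G S u v n) (hn : 0 < n) :
    u ≠ v := by
  cases h with
  | nil => omega
  | cons _ hu hp => rintro rfl; exact hu hp.right_mem

theorem uncons {S : Finset V} {u v : V} {n : ℕ} (h : PathOn G S u v (n + 1)) :
    ∃ w S', G.Adj u w ∧ u ∉ S' ∧ S = insert u S' ∧ PathOn G S' w v n := by
  cases h with
  | cons h1 h2 h3 => exact ⟨_, _, h1, h2, rfl, h3⟩

theorem unsnoc {S : Finset V} {u v : V} {n : ℕ} (h : PathOn G S u v (n + 1)) :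
    ∃ w S', G.Adj w v ∧ v ∉ S' ∧ S = insert v S' ∧ PathOn G S' u w n := by
  obtain ⟨w, S', h1, h2, h3, h4⟩ := h.symm.uncons
  exact ⟨w, S', h1.symm, h2, h3, h4.symm⟩

theorem pos_of_ne {S : Finset V} {u v : V} {n : ℕ} (h : PathOn G S u v n) (hn : u ≠ v) :
    0 < n := by
  rcases Nat.eq_zero_or_pos n with rfl | h'
  · exact absurd h.eq_of_length_zero.1 hn
  · exact h'

/-- A path between two sets can be shortened so that it meets them only in its ends. -/
theorem exists_segment {W X Y S : Finset V} {x y : V} {n : ℕ} (h : PathOn G S x y n)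
    (hS : S ⊆ W) (hx : x ∈ X) (hy : y ∈ Y) :
    ∃ S ⊆ W, ∃ m ∈ X, ∃ e ∈ Y, ∃ n, PathOn G S m e n ∧ (∀ z ∈ S, z ∈ X → z = m) ∧
      ∀ z ∈ S, z ∈ Y → z = e := by
  classical
  have hex : ∃ n, ∃ S ⊆ W, ∃ m ∈ X, ∃ e ∈ Y, PathOn G S m e n :=
    ⟨n, S, hS, x, hx, y, hy, h⟩
  obtain ⟨S, hS, m, hm, e, he, hp⟩ := Nat.find_spec hex
  refine ⟨S, hS, m, hm, e, he, _, hp, ?_, ?_⟩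
  · intro z hz hzX
    obtain ⟨S₁, S₂, a, b, h1, h2, h3, h4, h5⟩ := hp.split hz
    have := Nat.find_min' hex
      ⟨S₂, (h3 ▸ Finset.subset_union_right).trans hS, z, hzX, e, he, h2⟩
    obtain rfl : a = 0 := by omega
    exact h1.eq_of_length_zero.1.symm
  · intro z hz hzY
    obtain ⟨S₁, S₂, a, b, h1, h2, h3, h4, h5⟩ := hp.split hz
    have := Nat.find_min' hex
      ⟨S₁, (h3 ▸ Finset.subset_union_left).trans hS, m, hm, z, hzY, h1⟩
    obtain rfl : b = 0 := by omega
    exact h2.eq_of_length_zero.1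

/-- Two walks glued at a vertex contain a path. -/
theorem exists_trans {S S' : Finset V} {u v w : V} {n m : ℕ} (h : PathOn G S u v n)
    (h' : PathOn G S' v w m) : ∃ S₀ ⊆ S ∪ S', ∃ k, PathOn G S₀ u w k := by
  obtain ⟨T, hT, a, ha, e, he, k, hk, h1, h2⟩ :=
    h.exists_segment (W := S) (X := {u}) (Y := S') subset_rfl (by simp) h'.left_mem
  obtain rfl := Finset.mem_singleton.1 ha
  obtain ⟨S₁, S₂, c, d, h3, h4, h5, -, -⟩ := h'.split he
  refine ⟨T ∪ S₂, ?_, _, hk.append h4 fun z hz hz' => h2 z hz (h5 ▸ Finset.mem_union_right _ hz')⟩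
  exact Finset.union_subset_union hT (h5 ▸ Finset.subset_union_right)

end PathOn

theorem Conn.insert {T : Finset V} (hT : Conn G T) {b t : V} (ht : t ∈ T) (h : G.Adj b t) :
    Conn G (insert b T) := by
  have key : ∀ v ∈ T, ∃ S ⊆ Insert.insert b T, ∃ n, PathOn G S b v n := by
    intro v hv
    obtain ⟨S, hS, n, hp⟩ := hT t ht v hv
    obtain ⟨S', hS', k, hk⟩ := (PathOn.of_adj h).exists_trans hp
    refine ⟨S', hS'.trans ?_, k, hk⟩
    intro z hz
    simp only [Finset.mem_union, Finset.mem_insert, Finset.mem_singleton] at hz ⊢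
    rcases hz with (rfl | rfl) | hz
    · simp
    · simp [ht]
    · simp [hS hz]
  intro u hu v hv
  rcases Finset.mem_insert.1 hu with rfl | hu' <;> rcases Finset.mem_insert.1 hv with rfl | hv'
  · exact ⟨{v}, by simp, 0, .nil v⟩
  · exact key v hv'
  · obtain ⟨S, hS, n, hp⟩ := key u hu'
    exact ⟨S, hS, n, hp.symm⟩
  · obtain ⟨S, hS, n, hp⟩ := hT u hu' v hv'
    exact ⟨S, hS.trans (Finset.subset_insert _ _), n, hp⟩

theorem HasCycle.mono {S S' : Finset V} (h : HasCycle G S) (hS : S ⊆ S') : HasCycle G S' := by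
  obtain ⟨S₀, h0, h1⟩ := h
  exact ⟨S₀, h0.trans hS, h1⟩

/-- Two disjoint paths joined by two edges form a cycle. -/
theorem HasCycle.of_ring {W S S' : Finset V} {u v u' v' : V} {n m : ℕ} (h : PathOn G S u v n)
    (h' : PathOn G S' u' v' m) (hS : S ⊆ W) (hS' : S' ⊆ W) (hd : Disjoint S S')
    (h1 : G.Adj u u') (h2 : G.Adj v v') (hpos : 0 < n + m) (h3 : 3 ∣ n + m + 2) :
    HasCycle G W :=
  ⟨_, Finset.union_subset hS hS', _, _, _, h.link h2 h'.symm hd, by omega, h1.symm, h3⟩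

open Classical in
/-- The number of neighbours of `v` in `S`. -/
noncomputable def deg (G : SimpleGraph V) (S : Finset V) (v : V) : ℕ := (S.filter (G.Adj v)).card

theorem deg_mono {S S' : Finset V} (h : S ⊆ S') (v : V) : deg G S v ≤ deg G S' v := by
  classical exact Finset.card_le_card (Finset.filter_subset_filter _ h)

theorem deg_union_le (S S' : Finset V) (v : V) : deg G (S ∪ S') v ≤ deg G S v + deg G S' v := by
  classical
  unfold deg
  rw [Finset.filter_union]
  exact Finset.card_union_le _ _

theorem deg_union {S S' : Finset V} (h : Disjoint S S') (v : V) :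
    deg G (S ∪ S') v = deg G S v + deg G S' v := by
  classical
  unfold deg
  rw [Finset.filter_union, Finset.card_union_of_disjoint (Finset.disjoint_filter_filter h)]

theorem deg_le_card (S : Finset V) (v : V) : deg G S v ≤ S.card := by
  classical exact Finset.card_filter_le _ _

theorem deg_le_deg_add_card_sdiff (S S' : Finset V) (v : V) :
    deg G S v ≤ deg G S' v + (S \ S').card := by
  have h : S ⊆ S' ∪ (S \ S') := by intro z hz; by_cases z ∈ S' <;> simp_all
  exact (deg_mono h v).trans ((deg_union_le _ _ _).trans (by gcongr; exact deg_le_card _ _))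

theorem deg_singleton_of_adj {u v : V} (h : G.Adj v u) : deg G {u} v = 1 := by
  simp [deg, Finset.filter_singleton, h]

theorem deg_insert_of_adj {S : Finset V} {u v : V} (hu : u ∉ S) (h : G.Adj v u) :
    deg G (insert u S) v = deg G S v + 1 := by
  rw [Finset.insert_eq, deg_union (by simpa using hu), deg_singleton_of_adj h, add_comm]

theorem deg_insert_of_not_adj {S : Finset V} {u v : V} (h : ¬G.Adj v u) :
    deg G (insert u S) v = deg G S v := by
  unfold deg; rw [Finset.filter_insert, if_neg h]

theorem deg_insert_self (S : Finset V) (v : V) : deg G (insert v S) v = deg G S v :=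
  deg_insert_of_not_adj (G.irrefl)

theorem deg_erase_of_adj {S : Finset V} {u v : V} (hu : u ∈ S) (h : G.Adj v u) :
    deg G (S.erase u) v + 1 = deg G S v := by
  rw [← deg_insert_of_adj (Finset.notMem_erase u S) h, Finset.insert_erase hu]

theorem deg_erase_of_not_adj {S : Finset V} {u v : V} (h : ¬G.Adj v u) :
    deg G (S.erase u) v = deg G S v := by
  by_cases hu : u ∈ S
  · rw [← deg_insert_of_not_adj (S := S.erase u) h, Finset.insert_erase hu]
  · rw [Finset.erase_eq_of_notMem hu]

theorem deg_erase_self (S : Finset V) (v : V) : deg G (S.erase v) v = deg G S v :=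
  deg_erase_of_not_adj G.irrefl

theorem le_deg_erase_add_one (S : Finset V) (u v : V) : deg G S v ≤ deg G (S.erase u) v + 1 := by
  by_cases h : G.Adj v u
  · by_cases hu : u ∈ S
    · rw [deg_erase_of_adj hu h]
    · rw [Finset.erase_eq_of_notMem hu]; omega
  · rw [deg_erase_of_not_adj h]; omega

theorem exists_adj_notMem {S F : Finset V} {v : V} (h : F.card < deg G S v) :
    ∃ w ∈ S, G.Adj v w ∧ w ∉ F := by
  obtain ⟨w, hw, hF⟩ := Finset.exists_mem_notMem_of_card_lt_card h
  simp only [Finset.mem_filter] at hw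
  exact ⟨w, hw.1, hw.2, hF⟩

theorem exists_adj {S : Finset V} {v : V} (h : 0 < deg G S v) : ∃ w ∈ S, G.Adj v w := by
  obtain ⟨w, h1, h2, -⟩ := exists_adj_notMem (F := ∅) (by simpa using h)
  exact ⟨w, h1, h2⟩

theorem deg_pos {S : Finset V} {v w : V} (hw : w ∈ S) (h : G.Adj v w) : 0 < deg G S v :=
  Finset.card_pos.2 ⟨w, by simp [hw, h]⟩

theorem card_le_deg {S F : Finset V} {v : V} (h : ∀ w ∈ F, w ∈ S ∧ G.Adj v w) :
    F.card ≤ deg G S v :=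
  Finset.card_le_card fun w hw => by simpa using h w hw

theorem deg_le_card_of_forall {S F : Finset V} {v : V} (h : ∀ w ∈ S, G.Adj v w → w ∈ F) :
    deg G S v ≤ F.card :=
  Finset.card_le_card fun w hw => by
    simp only [Finset.mem_filter] at hw
    exact h w hw.1 hw.2

theorem two_le_deg {S : Finset V} {v a b : V} (ha : a ∈ S) (hb : b ∈ S) (hab : a ≠ b)
    (h1 : G.Adj v a) (h2 : G.Adj v b) : 2 ≤ deg G S v := by
  rw [← Finset.card_pair hab]
  refine card_le_deg fun w hw => ?_
  simp only [Finset.mem_insert, Finset.mem_singleton] at hw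
  rcases hw with rfl | rfl <;> simp [*]

theorem deg_congr {S S' : Finset V} {v : V} (h : ∀ w, G.Adj v w → (w ∈ S ↔ w ∈ S')) :
    deg G S v = deg G S' v := by
  unfold deg
  congr 1
  ext w
  simp only [Finset.mem_filter, and_congr_left_iff]
  exact h w

theorem sum_deg_insert {X : Finset V} {v : V} (hv : v ∉ X) :
    ∑ u ∈ insert v X, deg G (insert v X) u = ∑ u ∈ X, deg G X u + 2 * deg G X v := by
  classical
  rw [Finset.sum_insert hv, deg_insert_self]
  have : ∑ u ∈ X, deg G (insert v X) u = ∑ u ∈ X, (deg G X u + if G.Adj v u then 1 else 0) := by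
    refine Finset.sum_congr rfl fun u _ => ?_
    split_ifs with h
    · exact deg_insert_of_adj hv h.symm
    · exact deg_insert_of_not_adj fun h' => h h'.symm
  rw [this, Finset.sum_add_distrib]
  have : ∑ u ∈ X, (if G.Adj v u then 1 else 0) = deg G X v := by
    unfold deg
    rw [Finset.card_filter]
  omega

theorem sum_deg_erase {X : Finset V} {v : V} (hv : v ∈ X) :
    ∑ u ∈ X, deg G X u = ∑ u ∈ X.erase v, deg G (X.erase v) u + 2 * deg G X v := by
  have := sum_deg_insert (G := G) (Finset.notMem_erase v X)
  rwa [Finset.insert_erase hv, deg_erase_self] at this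

/-- The graph induced on `R` contains a cycle. -/
def Core (G : SimpleGraph V) (R : Finset V) : Prop :=
  ∃ Y ⊆ R, Y.Nonempty ∧ ∀ v ∈ Y, 2 ≤ deg G Y v

theorem Core.mono {R R' : Finset V} (h : Core G R) (hR : R ⊆ R') : Core G R' := by
  obtain ⟨Y, hY, h⟩ := h
  exact ⟨Y, hY.trans hR, h⟩

theorem sum_deg_add_two_le {X : Finset V} (hX : X.Nonempty) (h : ¬Core G X) :
    ∑ v ∈ X, deg G X v + 2 ≤ 2 * X.card := by
  induction hn : X.card generalizing X with
  | zero => simp_all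
  | succ n ih =>
    have : ∃ v ∈ X, deg G X v ≤ 1 := by
      by_contra! h'
      exact h ⟨X, subset_rfl, hX, h'⟩
    obtain ⟨v, hv, hd⟩ := this
    rw [sum_deg_erase hv]
    have hc := Finset.card_erase_of_mem hv
    rcases (X.erase v).eq_empty_or_nonempty with he | he
    · have : deg G X v = 0 := by
        rw [← deg_erase_self, he]; simp [deg]
      rw [this, he]; simp
    · have := ih he (fun h' => h (h'.mono (Finset.erase_subset _ _))) (by omega)
      omega

/-- `R` is the vertex set of a cycle of length `L`, traversed periodically by `c`. -/
structure IsCyc (G : SimpleGraph V) (R : Finset V) (L : ℕ) (c : ℕ → V) : Prop where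
  three_le : 3 ≤ L
  inj : ∀ i j, c i = c j ↔ i ≡ j [MOD L]
  adj : ∀ i, G.Adj (c i) (c (i + 1))
  mem : ∀ v, v ∈ R ↔ ∃ i, c i = v

theorem PathOn.exists_fun {S : Finset V} {u v : V} {n : ℕ} (h : PathOn G S u v n) :
    ∃ c : ℕ → V, c 0 = u ∧ c n = v ∧ (∀ i < n, G.Adj (c i) (c (i + 1))) ∧
      (∀ i ≤ n, ∀ j ≤ n, c i = c j → i = j) ∧ ∀ z, z ∈ S ↔ ∃ i ≤ n, c i = z := by
  induction h with
  | nil u => exact ⟨fun _ => u, rfl, rfl, by simp, by omega, by simp [eq_comm]⟩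
  | @cons S u w v n hux hu hp ih =>
    obtain ⟨c, h0, hn, ha, hi, hm⟩ := ih
    refine ⟨fun i => Nat.casesOn i u c, rfl, hn, ?_, ?_, ?_⟩
    · rintro (_ | i) h
      · simpa [h0] using hux
      · exact ha i (by omega)
    · rintro (_ | i) hi' (_ | j) hj' hij
      · rfl
      · exact absurd ((hm u).2 ⟨j, by omega, hij.symm⟩) hu
      · exact absurd ((hm u).2 ⟨i, by omega, hij⟩) hu
      · simpa using hi i (by omega) j (by omega) hij
    · intro z
      rw [Finset.mem_insert, hm]
      constructor
      · rintro (rfl | ⟨i, hi, rfl⟩)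
        · exact ⟨0, by omega, rfl⟩
        · exact ⟨i + 1, by omega, rfl⟩
      · rintro ⟨_ | i, hi, rfl⟩
        · exact .inl rfl
        · exact .inr ⟨i, by omega, rfl⟩

theorem PathOn.exists_isCyc {S : Finset V} {u v : V} {n : ℕ} (h : PathOn G S u v n)
    (hn : 2 ≤ n) (hvu : G.Adj v u) : ∃ c, IsCyc G S (n + 1) c := by
  obtain ⟨c, h0, hcn, ha, hi, hm⟩ := h.exists_fun
  have hlt : ∀ i, i % (n + 1) ≤ n := fun i => Nat.lt_succ_iff.1 (Nat.mod_lt _ (by omega))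
  refine ⟨fun i => c (i % (n + 1)), by omega, ?_, ?_, ?_⟩
  · intro i j
    constructor
    · intro h
      exact hi _ (hlt i) _ (hlt j) h
    · intro h
      exact congrArg c h
  · intro i
    rcases (hlt i).lt_or_eq with h | h
    · have : (i + 1) % (n + 1) = i % (n + 1) + 1 := by
        rw [Nat.add_mod, Nat.mod_eq_of_lt (a := 1) (by omega), Nat.mod_eq_of_lt (by omega)]
      rw [this]
      exact ha _ h
    · have : (i + 1) % (n + 1) = 0 := by
        rw [Nat.add_mod, Nat.mod_eq_of_lt (a := 1) (by omega), h, Nat.mod_self]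
      rw [this, h, hcn, h0]
      exact hvu
  · intro z
    rw [hm]
    constructor
    · rintro ⟨i, hi, rfl⟩
      exact ⟨i, by simp only [Nat.mod_eq_of_lt (Nat.lt_succ_iff.2 hi)]⟩
    · rintro ⟨i, rfl⟩
      exact ⟨_, hlt i, rfl⟩

namespace IsCyc

variable {R : Finset V} {L : ℕ} {c : ℕ → V}

theorem apply_mem (h : IsCyc G R L c) (i : ℕ) : c i ∈ R := (h.mem _).2 ⟨i, rfl⟩

theorem apply_add_self (h : IsCyc G R L c) (i : ℕ) : c (i + L) = c i :=
  (h.inj _ _).2 (by simp [Nat.ModEq])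

theorem apply_ne (h : IsCyc G R L c) {i j : ℕ} (h1 : i < j) (h2 : j < i + L) : c i ≠ c j := by
  intro he
  have := (Nat.modEq_iff_dvd' h1.le).1 ((h.inj _ _).1 he)
  have := Nat.le_of_dvd (by omega) this
  omega

theorem adj' (h : IsCyc G R L c) (i : ℕ) : G.Adj (c (i + 1)) (c i) := (h.adj i).symm

theorem two_le_deg (h : IsCyc G R L c) {v : V} (hv : v ∈ R) : 2 ≤ deg G R v := by
  obtain ⟨i, rfl⟩ := (h.mem v).1 hv
  have h3 := h.three_le
  have e : c (i + L) = c i := h.apply_add_self i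
  refine ModThree.two_le_deg (h.apply_mem (i + 1)) (h.apply_mem (i + L - 1))
    (h.apply_ne (by omega) (by omega)) (h.adj i) ?_
  have := h.adj' (i + L - 1)
  rwa [show i + L - 1 + 1 = i + L by omega, e] at this

theorem arc (h : IsCyc G R L c) (i : ℕ) {d : ℕ} (hd : d < L) :
    PathOn G ((Finset.range (d + 1)).image fun k => c (i + k)) (c i) (c (i + d)) d := by
  induction d with
  | zero => simpa using PathOn.nil (G := G) (c i)
  | succ d ih =>
    have := (PathOn.cons (h.adj' (i + d)) ?_ (ih (by omega)).symm).symm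
    · rwa [Finset.range_add_one, Finset.image_insert]
    · simp only [Finset.mem_image, Finset.mem_range, not_exists, not_and]
      intro k hk
      exact h.apply_ne (by omega) (by omega)

theorem card_eq (h : IsCyc G R L c) : R.card = L := by
  have h3 := h.three_le
  have := (h.arc 0 (d := L - 1) (by omega)).card_eq
  have e : R = (Finset.range (L - 1 + 1)).image fun k => c (0 + k) := by
    ext v
    rw [h.mem]
    simp only [zero_add, Finset.mem_image, Finset.mem_range]
    constructor
    · rintro ⟨i, rfl⟩
      exact ⟨i % L, by have := Nat.mod_lt i (show 0 < L by omega); omega,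
        (h.inj _ _).2 (Nat.mod_modEq _ _)⟩
    · rintro ⟨i, -, rfl⟩
      exact ⟨i, rfl⟩
  rw [e, this]; omega

theorem shift (h : IsCyc G R L c) (k : ℕ) : IsCyc G R L fun i => c (k + i) where
  three_le := h.three_le
  inj i j := by rw [h.inj]; exact ⟨Nat.ModEq.add_left_cancel' _, Nat.ModEq.add_left _⟩
  adj i := h.adj _
  mem v := by
    rw [h.mem]
    constructor
    · rintro ⟨i, rfl⟩
      refine ⟨i + k * (L - 1), (h.inj _ _).2 ?_⟩
      have h3 := h.three_le
      obtain ⟨l, rfl⟩ : ∃ l, L = l + 1 := ⟨L - 1, by omega⟩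
      have : k + (i + k * (l + 1 - 1)) = i + (l + 1) * k := by simp; ring
      rw [this]
      simp [Nat.ModEq]
    · rintro ⟨i, rfl⟩
      exact ⟨_, rfl⟩

theorem hasCycle (h : IsCyc G R L c) (h3 : 3 ∣ L) : HasCycle G R := by
  have h3' := h.three_le
  refine ⟨_, ?_, _, _, _, h.arc 0 (d := L - 1) (by omega), by omega, ?_, ?_⟩
  · intro z hz
    simp only [Finset.mem_image] at hz
    obtain ⟨i, -, rfl⟩ := hz
    exact h.apply_mem _
  · have := h.adj (0 + (L - 1))
    rwa [show 0 + (L - 1) + 1 = 0 + L by omega, h.apply_add_self] at this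
  · rwa [show L - 1 + 1 = L by omega]

end IsCyc

theorem exists_isCyc_of_two_le_deg {R : Finset V} (hR : R.Nonempty)
    (h : ∀ v ∈ R, 2 ≤ deg G R v) : ∃ S ⊆ R, ∃ L c, IsCyc G S L c := by
  classical
  have hex : ∃ m, ∃ n, m + n = R.card ∧ ∃ S ⊆ R, ∃ u v, PathOn G S u v n := by
    obtain ⟨u, hu⟩ := hR
    exact ⟨R.card, 0, rfl, {u}, by simpa using hu, u, u, .nil u⟩
  obtain ⟨n, hn, S, hS, u, v, hp⟩ := Nat.find_spec hex
  have hnb : ∀ z ∈ R, G.Adj u z → z ∈ S := by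
    intro z hz huz
    by_contra hzS
    have hq := PathOn.cons huz.symm hzS hp
    have hsub : insert z S ⊆ R := Finset.insert_subset hz hS
    have h1 := Finset.card_le_card hsub
    rw [hq.card_eq] at h1
    have := Nat.find_min' hex ⟨n + 1, Nat.sub_add_cancel (m := n + 1) (by omega), _, hsub, _, _, hq⟩
    omega
  have hu : u ∈ R := hS hp.left_mem
  obtain ⟨w, hw, huw, -⟩ := exists_adj_notMem (G := G) (S := R) (F := ∅) (v := u)
    (by have := h u hu; simp; omega)
  rcases n with _ | n
  · obtain ⟨-, rfl⟩ := hp.eq_of_length_zero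
    have := hnb w hw huw
    simp only [Finset.mem_singleton] at this
    exact absurd this huw.ne'
  obtain ⟨y, S', h1, h2, rfl, h3⟩ := hp.uncons
  obtain ⟨z, hz, huz, hzy⟩ := exists_adj_notMem (G := G) (S := R) (F := {y}) (v := u)
    (by have := h u hu; simp; omega)
  have hzS : z ∈ S' := (Finset.mem_insert.1 (hnb z hz huz)).resolve_left huz.ne'
  obtain ⟨S₁, S₂, a, b, h4, h5, h6, -, -⟩ := h3.split hzS
  have ha : 0 < a := h4.pos_of_ne (by rintro rfl; simp at hzy)
  have h7 := PathOn.cons h1 (fun h' => h2 (h6 ▸ Finset.mem_union_left _ h')) h4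
  obtain ⟨c, hc⟩ := h7.exists_isCyc (by omega) huz.symm
  refine ⟨_, ?_, _, c, hc⟩
  refine (Finset.insert_subset_insert _ ?_).trans hS
  exact h6 ▸ Finset.subset_union_left

/-- The properties of a minimal set `S` in which all degrees but that of `x` are at least three
and which contains no cycle of length divisible by three. -/
structure Crit (G : SimpleGraph V) (S : Finset V) (x : V) : Prop where
  mem : x ∈ S
  two_le : 2 ≤ deg G S x
  three_le : ∀ v ∈ S, v ≠ x → 3 ≤ deg G S v
  not_hasCycle : ¬HasCycle G S
  bdry : ∀ R ⊆ S, R ≠ S → 2 ≤ R.card → ∀ b₀, ∃ b ∈ R, b ≠ b₀ ∧ ∃ t ∈ S \ R, G.Adj b t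

namespace Crit

variable {S : Finset V} {x : V}

theorem isCyc_sdiff (h : Crit G S x) {U : Finset V} (hU : U ⊆ S) (hne : U.Nonempty)
    (hcore : Core G (S \ U))
    (hmax : ∀ b ∈ S \ U, (∃ t ∈ U, G.Adj b t) → ¬Core G ((S \ U).erase b)) :
    ∃ L c, IsCyc G (S \ U) L c ∧ ∀ v ∈ S \ U, v ≠ x → ∃ t ∈ U, G.Adj v t := by
  set R := S \ U with hRdef
  have hRS : R ⊆ S := Finset.sdiff_subset
  have hSR : S \ R = U := by rw [hRdef, Finset.sdiff_sdiff_eq_self hU]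
  have hnb : ∀ v ∈ R, (¬∃ t ∈ U, G.Adj v t) → deg G R v = deg G S v := by
    intro v hv hv'
    refine deg_congr fun w hw => ⟨fun h => hRS h, fun h => ?_⟩
    by_contra hwR
    exact hv' ⟨w, by rw [← hSR]; simp [h, hwR], hw⟩
  have hall : ∀ Y ⊆ R, Y.Nonempty → (∀ v ∈ Y, 2 ≤ deg G Y v) → ∀ b ∈ R,
      (∃ t ∈ U, G.Adj b t) → b ∈ Y := by
    intro Y hY hYne hd b hb hbt
    by_contra hbY
    exact hmax b hb hbt ⟨Y, fun z hz => Finset.mem_erase.2 ⟨by rintro rfl; exact hbY hz, hY hz⟩,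
      hYne, hd⟩
  obtain ⟨Y, hY, hYne, hYd⟩ := hcore
  have hRne : R.Nonempty := hYne.mono hY
  have hd2 : ∀ v ∈ R, 2 ≤ deg G R v := by
    intro v hv
    by_cases hv' : ∃ t ∈ U, G.Adj v t
    · exact (hYd v (hall Y hY hYne hYd v hv hv')).trans (deg_mono hY v)
    · rw [hnb v hv hv']
      by_cases hvx : v = x
      · exact hvx ▸ h.two_le
      · exact (by omega : 2 ≤ 3).trans (h.three_le v (hRS hv) hvx)
  have hcard : 3 ≤ R.card := by
    obtain ⟨v, hv⟩ := hRne
    have h1 := hd2 v hv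
    have h2 := deg_le_card (G := G) (R.erase v) v
    rw [deg_erase_self, Finset.card_erase_of_mem hv] at h2
    omega
  have hne' : R ≠ S := by
    rintro he
    rw [he, Finset.sdiff_self] at hSR
    exact hne.ne_empty hSR.symm
  have hbd : ∀ b₀, ∃ b ∈ R, b ≠ b₀ ∧ ∃ t ∈ U, G.Adj b t := by
    have := h.bdry R hRS hne' (by omega)
    rwa [hSR] at this
  have hsum : ∀ b ∈ R, (∃ t ∈ U, G.Adj b t) →
      ∑ v ∈ R, deg G R v + 4 ≤ 2 * R.card + 2 * deg G R b := by
    intro b hb hbt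
    have h1 : (R.erase b).card + 1 = R.card := Finset.card_erase_add_one hb
    have h2 := sum_deg_add_two_le (Finset.card_pos.1 (by omega)) (hmax b hb hbt)
    rw [sum_deg_erase hb]
    omega
  have hconst : ∀ b ∈ R, (∃ t ∈ U, G.Adj b t) → ∀ F ⊆ R,
      ∑ v ∈ F, (deg G R v - 2) + 2 ≤ 2 * deg G R b - 2 := by
    intro b hb hbt F hF
    have h1 : ∑ v ∈ F, (deg G R v - 2) ≤ ∑ v ∈ R, (deg G R v - 2) :=
      Finset.sum_le_sum_of_subset hF
    have h2 : ∑ v ∈ R, deg G R v = ∑ v ∈ R, (deg G R v - 2) + 2 * R.card := by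
      rw [mul_comm, ← smul_eq_mul, ← Finset.sum_const, ← Finset.sum_add_distrib]
      exact Finset.sum_congr rfl fun v hv => (Nat.sub_add_cancel (hd2 v hv)).symm
    have h3 := hsum b hb hbt
    have h4 := hd2 b hb
    omega
  have hbound : ∀ b ∈ R, (∃ t ∈ U, G.Adj b t) → deg G R b = 2 := by
    obtain ⟨b, hb, -, hbt⟩ := hbd x
    obtain ⟨b', hb', hne, hbt'⟩ := hbd b
    have hpair : ∀ {p q : V}, p ∈ R → q ∈ R → p ≠ q → ∀ r ∈ R, (∃ t ∈ U, G.Adj r t) →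
        (deg G R p - 2) + (deg G R q - 2) + 2 ≤ 2 * deg G R r - 2 := by
      intro p q hp hq hpq r hr hrt
      have := hconst r hr hrt {p, q} (by intro z hz; simp at hz; rcases hz with rfl | rfl <;> assumption)
      rwa [Finset.sum_pair hpq] at this
    have e1 := hpair hb hb' hne.symm b hb hbt
    have e2 := hpair hb hb' hne.symm b' hb' hbt'
    have e3 := hd2 b hb
    have e4 := hd2 b' hb'
    have key : deg G R b = 2 := by
      by_contra hb2
      have hother : ∀ z ∈ R, z = b ∨ z = b' ∨ z = x := by
        intro z hz
        by_contra! hz'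
        have h1 := hconst b hb hbt {z, b, b'} (by
          intro y hy; simp at hy; rcases hy with rfl | rfl | rfl <;> assumption)
        rw [Finset.sum_insert (by simp [hz'.1, hz'.2.1]), Finset.sum_pair hne.symm] at h1
        have h2 := hd2 z hz
        by_cases hzt : ∃ t ∈ U, G.Adj z t
        · have := hpair hb hb' hne.symm z hz hzt
          omega
        · have := h.three_le z (hRS hz) hz'.2.2
          rw [← hnb z hz hzt] at this
          omega
      have : deg G R b ≤ ({b', x} : Finset V).card := by
        refine deg_le_card_of_forall fun z hz hbz => ?_
        have := hother z hz
        have := hbz.ne'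
        simp; tauto
      have := Finset.card_le_two (a := b') (b := x)
      omega
    intro z hz hzt
    have e5 := hd2 z hz
    by_cases hzb : z = b
    · rw [hzb, key]
    · have := hpair hz hb hzb b hb hbt
      omega
  have hatt : ∀ v ∈ R, v ≠ x → ∃ t ∈ U, G.Adj v t := by
    intro v hv hvx
    by_contra hvt
    have h1 := h.three_le v (hRS hv) hvx
    rw [← hnb v hv hvt] at h1
    obtain ⟨b, hb, -, hbt⟩ := hbd x
    have h2 := hbound b hb hbt
    have h3 := hconst b hb hbt {v} (by simpa using hv)
    rw [Finset.sum_singleton] at h3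
    omega
  obtain ⟨S', hS', L, c, hc⟩ := exists_isCyc_of_two_le_deg hRne hd2
  suffices S' = R from ⟨L, c, this ▸ hc, hatt⟩
  have hin := hall S' hS' ⟨c 0, hc.apply_mem 0⟩ fun v hv => hc.two_le_deg hv
  refine hS'.antisymm fun v hv => ?_
  by_contra hvS
  have hvx : v = x := by
    by_contra hvx
    exact hvS (hin v hv (hatt v hv hvx))
  subst hvx
  obtain ⟨y, hy, hvy⟩ := exists_adj (G := G) (S := R) (v := v) (by have := hd2 v hv; omega)
  have hyt := hatt y hy hvy.ne'
  have h1 := hbound y hy hyt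
  have h2 := hc.two_le_deg (hin y hy hyt)
  have h3 := deg_mono (G := G) (Finset.insert_subset hv hS') y
  rw [deg_insert_of_adj hvS hvy.symm] at h3
  omega

theorem exists_isCyc (h : Crit G S x) {U₀ : Finset V} (hU₀ : U₀ ⊆ S) (hne : U₀.Nonempty)
    (hconn : Conn G U₀) (hcore : Core G (S \ U₀)) :
    ∃ U, U₀ ⊆ U ∧ U ⊆ S ∧ Conn G U ∧
      ∃ L c, IsCyc G (S \ U) L c ∧ ∀ v ∈ S \ U, v ≠ x → ∃ t ∈ U, G.Adj v t := by
  classical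
  induction hn : (S \ U₀).card using Nat.strong_induction_on generalizing U₀ with
  | _ n ih =>
  by_cases hmax : ∀ b ∈ S \ U₀, (∃ t ∈ U₀, G.Adj b t) → ¬Core G ((S \ U₀).erase b)
  · exact ⟨U₀, subset_rfl, hU₀, hconn, h.isCyc_sdiff hU₀ hne hcore hmax⟩
  · push Not at hmax
    obtain ⟨b, hb, ⟨t, ht, hbt⟩, hc⟩ := hmax
    have e : S \ insert b U₀ = (S \ U₀).erase b := by
      rw [Finset.sdiff_insert]
    obtain ⟨U, h1, h2⟩ := ih _ (by rw [← hn, e]; exact Finset.card_erase_lt_of_mem hb)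
      (Finset.insert_subset (Finset.mem_sdiff.1 hb).1 hU₀) (Finset.insert_nonempty _ _)
      (hconn.insert ht hbt) (e ▸ hc) rfl
    exact ⟨U, (Finset.subset_insert _ _).trans h1, h2⟩

end Crit

/-- There is a path of length `n` from `u` to `v` inside `T`. -/
def Joined (G : SimpleGraph V) (T : Finset V) (u v : V) (n : ℕ) : Prop :=
  ∃ S ⊆ T, PathOn G S u v n

theorem Joined.symm {T : Finset V} {u v : V} {n : ℕ} (h : Joined G T u v n) : Joined G T v u n := by
  obtain ⟨S, hS, h⟩ := h
  exact ⟨S, hS, h.symm⟩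

/-- There are disjoint paths of lengths `n` from `u` to `v` and `m` from `u'` to `v'` in `T`. -/
def Joined₂ (G : SimpleGraph V) (T : Finset V) (u v : V) (n : ℕ) (u' v' : V) (m : ℕ) : Prop :=
  ∃ S ⊆ T, ∃ S' ⊆ T, Disjoint S S' ∧ PathOn G S u v n ∧ PathOn G S' u' v' m

theorem Joined₂.symm_right {T : Finset V} {u v u' v' : V} {n m : ℕ}
    (h : Joined₂ G T u v n u' v' m) : Joined₂ G T u v n v' u' m := by
  obtain ⟨S, hS, S', hS', hd, h1, h2⟩ := h
  exact ⟨S, hS, S', hS', hd, h1, h2.symm⟩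

/-- Lengths of paths among `a`, `e` and the ends of a `b`–`d` path of length `n` to which `a` and
`e` are attached by disjoint paths, with `a` attached on the side of `b`. -/
def Bridge (G : SimpleGraph V) (T : Finset V) (b d a e : V) (n : ℕ) : Prop :=
  ∃ μ ν p q s, n = p + q + s ∧ Joined G T a b (μ + p) ∧ Joined G T a d (μ + q + s) ∧
    Joined G T e b (ν + p + q) ∧ Joined G T e d (ν + s) ∧ Joined G T a e (μ + ν + q) ∧
    (0 < q → Joined₂ G T a b (μ + p) e d (ν + s))

theorem bridge_of_split {T M M' Q₁ Q₂ : Finset V} {a b d e m m' : V} {μ ν p k : ℕ}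
    (hM : M ⊆ T) (hM' : M' ⊆ T) (hQ₁ : Q₁ ⊆ T) (hQ₂ : Q₂ ⊆ T)
    (h1 : PathOn G M a m μ) (h2 : PathOn G M' e m' ν) (h3 : PathOn G Q₁ b m p)
    (h4 : PathOn G Q₂ m d k) (h12 : ∀ y ∈ Q₁, y ∈ Q₂ → y = m)
    (hMm : ∀ z ∈ M, z ∈ Q₁ ∪ Q₂ → z = m) (hMm' : ∀ z ∈ M', z ∈ Q₁ ∪ Q₂ → z = m')
    (hMM' : ∀ z ∈ M, z ∈ M' → z = m') (hm' : m' ∈ Q₂) : Bridge G T b d a e (p + k) := by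
  obtain ⟨R₁, R₂, q, s, h5, h6, h7, h8, h9⟩ := h4.split hm'
  have m1 := h1.right_mem
  have m2 := h2.right_mem
  have m3 := h3.right_mem
  have m5 := h5.left_mem
  have m6 := h5.right_mem
  have m7 := h6.left_mem
  have hR : ∀ z, z ∈ Q₂ ↔ z ∈ R₁ ∨ z ∈ R₂ := by rw [← h7]; simp
  have hR₁ : R₁ ⊆ T := fun z hz => hQ₂ ((hR z).2 (.inl hz))
  have hR₂ : R₂ ⊆ T := fun z hz => hQ₂ ((hR z).2 (.inr hz))
  have e1 := h1.append h3.symm (by grind)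
  have e2 := (h1.append h5 (by grind)).append h6 (by grind)
  have e3 := h2.append (h5.symm.append h3.symm (by grind)) (by grind)
  have e4 := h2.append h6 (by grind)
  have e5 := (h1.append h5 (by grind)).append h2.symm (by grind)
  rw [← add_assoc, add_right_comm] at e3
  rw [add_right_comm] at e5
  refine ⟨μ, ν, p, q, s, by omega, ⟨_, ?_, e1⟩, ⟨_, ?_, e2⟩, ⟨_, ?_, e3⟩, ⟨_, ?_, e4⟩,
    ⟨_, ?_, e5⟩, fun hq => ⟨_, ?_, _, ?_, ?_, e1, e4⟩⟩
  rotate_right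
  · have := h5.ne_of_pos hq
    rw [Finset.disjoint_left]
    grind
  all_goals grind

theorem joined_or_bridge {T Q : Finset V} (hT : Conn G T) (hQ : Q ⊆ T) {a b d e : V} {n : ℕ}
    (h : PathOn G Q b d n) (ha : a ∈ T) (he : e ∈ T) :
    (∃ k, Joined₂ G T a e k b d n) ∨ Bridge G T b d a e n ∨ Bridge G T d b a e n := by
  obtain ⟨P, hP, k, hp⟩ := hT a ha b (hQ h.left_mem)
  obtain ⟨M, hM, a', ha', m, hm, μ, h1, -, h2⟩ :=
    hp.exists_segment hP (Finset.mem_singleton_self a) h.left_mem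
  obtain rfl := Finset.mem_singleton.1 ha'
  obtain ⟨P, hP, k, hp⟩ := hT e he b (hQ h.left_mem)
  obtain ⟨M', hM', e', he', m', hm', ν, h3, -, h4⟩ :=
    hp.exists_segment hP (Finset.mem_singleton_self e)
      (Finset.mem_union_left M h.left_mem)
  obtain rfl := Finset.mem_singleton.1 he'
  by_cases hmQ : m' ∈ Q
  · right
    obtain ⟨Q₁, Q₂, p, s, h5, h6, rfl, h8, rfl⟩ := h.split hm
    have hQ₁ : Q₁ ⊆ T := Finset.subset_union_left.trans hQ
    have hQ₂ : Q₂ ⊆ T := Finset.subset_union_right.trans hQ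
    rcases Finset.mem_union.1 hmQ with h9 | h9
    · right
      rw [add_comm]
      exact bridge_of_split hM hM' hQ₂ hQ₁ h1 h3 h6.symm h5.symm (by grind) (by grind) (by grind)
        (by grind) h9
    · left
      exact bridge_of_split hM hM' hQ₁ hQ₂ h1 h3 h5 h6 (by grind) (by grind) (by grind)
        (by grind) h9
  · left
    have hmM : m' ∈ M := (Finset.mem_union.1 hm').resolve_left hmQ
    obtain ⟨M₁, M₂, p, s, h5, h6, rfl, h8, rfl⟩ := h1.split hmM
    have := h6.right_mem
    have := h6.left_mem
    refine ⟨_, _, ?_, Q, hQ, ?_, h5.append h3.symm (by grind), h⟩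
    · grind
    · rw [Finset.disjoint_left]
      grind

theorem Joined₂.exists_link {T : Finset V} (hT : Conn G T) {a b e f : V} {k n : ℕ}
    (h : Joined₂ G T a b k e f n) : ∃ p q r s μ, p + q = k ∧ r + s = n ∧
      Joined G T a e (p + μ + r) ∧ Joined G T a f (p + μ + s) ∧
      Joined G T b e (q + μ + r) ∧ Joined G T b f (q + μ + s) := by
  obtain ⟨Q, hQ, R, hR, hd, hq, hr⟩ := h
  rw [Finset.disjoint_left] at hd
  obtain ⟨M, hM, l, hm⟩ := hT _ (hQ hq.left_mem) _ (hR hr.left_mem)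
  obtain ⟨M, hM, m, hm, e', he, μ, h6, h7, h8⟩ := hm.exists_segment hM hq.left_mem hr.left_mem
  obtain ⟨Q₁, Q₂, p, q, b1, b2, rfl, b3, rfl⟩ := hq.split hm
  obtain ⟨R₁, R₂, u, v, b4, b5, rfl, b6, rfl⟩ := hr.split he
  exact ⟨p, q, u, v, μ, rfl, rfl,
    ⟨_, by grind, (b1.append h6 (by grind)).append b4.symm (by grind)⟩,
    ⟨_, by grind, (b1.append h6 (by grind)).append b5 (by grind)⟩,
    ⟨_, by grind, (b2.symm.append h6 (by grind)).append b4.symm (by grind)⟩,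
    ⟨_, by grind, (b2.symm.append h6 (by grind)).append b5 (by grind)⟩⟩

theorem Joined₂.reroute {T : Finset V} (hT : Conn G T) {a b e d x : V} {k n : ℕ}
    (h : Joined₂ G T a e k b d n) (hx : x ∈ T) :
    (∃ n', Joined₂ G T a e k b x n') ∨ ∃ k', Joined₂ G T x e k' b d n := by
  obtain ⟨P, hP, Q, hQ, hd, hp, hq⟩ := h
  rw [Finset.disjoint_left] at hd
  obtain ⟨M₀, hM₀, l₀, hm₀⟩ := hT x hx _ (hP hp.left_mem)
  obtain ⟨M, hM, t', ht', m, hm, l, h6, -, h7⟩ :=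
    hm₀.exists_segment hM₀ (Finset.mem_singleton_self _) (Finset.mem_union_left Q hp.left_mem)
  obtain rfl := Finset.mem_singleton.1 ht'
  by_cases hmQ : m ∈ Q
  · left
    have hmP : m ∉ P := fun h => hd h hmQ
    obtain ⟨Q₁, Q₂, p, r, h8, h9, rfl, h10, rfl⟩ := hq.split hmQ
    exact ⟨_, P, hP, _, by grind, by rw [Finset.disjoint_left]; grind, hp,
      (h6.append h8.symm (by grind)).symm⟩
  · right
    have hmP : m ∈ P := (Finset.mem_union.1 hm).resolve_right hmQ
    obtain ⟨P₁, P₂, p, r, h8, h9, rfl, h10, rfl⟩ := hp.split hmP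
    exact ⟨_, _, by grind, Q, hQ, by rw [Finset.disjoint_left]; grind, h6.append h9 (by grind), hq⟩

/-- A cycle `c` all of whose vertices `c i` have a neighbour `t i` in a connected set `T`, without
cycles of length divisible by three. -/
structure Attached (G : SimpleGraph V) (T C : Finset V) (L : ℕ) (c t : ℕ → V) : Prop where
  isCyc : IsCyc G C L c
  conn : Conn G T
  disj : Disjoint C T
  mem : ∀ i, t i ∈ T
  adj : ∀ i, G.Adj (c i) (t i)
  not_hasCycle : ¬HasCycle G (C ∪ T)

namespace Attached

variable {T C : Finset V} {L : ℕ} {c t : ℕ → V}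

theorem shift (h : Attached G T C L c t) (k : ℕ) :
    Attached G T C L (fun i => c (k + i)) (fun i => t (k + i)) :=
  ⟨h.isCyc.shift k, h.conn, h.disj, fun _ => h.mem _, fun _ => h.adj _, h.not_hasCycle⟩

theorem ring (h : Attached G T C L c t) {i d n : ℕ} (h0 : 0 < d) (hd : d < L)
    (hp : Joined G T (t i) (t (i + d)) n) : ¬3 ∣ n + d + 2 ∧ ¬3 ∣ n + (L - d) + 2 := by
  obtain ⟨P, hP, hp⟩ := hp
  have hsub : ∀ j e, ((Finset.range e).image fun k => c (j + k)) ⊆ C := by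
    intro j e z hz
    obtain ⟨k, -, rfl⟩ := Finset.mem_image.1 hz
    exact h.isCyc.apply_mem _
  have hdis : ∀ j e, Disjoint P ((Finset.range e).image fun k => c (j + k)) := fun j e =>
    (h.disj.mono (hsub j e) hP).symm
  constructor
  · intro h3
    exact h.not_hasCycle (.of_ring hp (h.isCyc.arc i hd) (hP.trans Finset.subset_union_right)
      ((hsub _ _).trans Finset.subset_union_left) (hdis _ _) (h.adj i).symm (h.adj _).symm
      (by omega) h3)
  · intro h3
    have ha := h.isCyc.arc (i + d) (d := L - d) (by omega)
    rw [show i + d + (L - d) = i + L by omega, h.isCyc.apply_add_self] at ha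
    exact h.not_hasCycle (.of_ring hp ha.symm (hP.trans Finset.subset_union_right)
      ((hsub _ _).trans Finset.subset_union_left) (hdis _ _) (h.adj i).symm (h.adj _).symm
      (by omega) h3)

theorem cross (h : Attached G T C L c t) {i j i' j' k n : ℕ}
    (hp : Joined₂ G T (t i) (t j) k (t i') (t j') n) (h1 : G.Adj (c i) (c i'))
    (h2 : G.Adj (c j) (c j')) (h3 : c i ≠ c j) (h4 : c i' ≠ c j') (h5 : c i ≠ c j')
    (h6 : c j ≠ c i') : ¬3 ∣ k + n := by
  intro hdvd
  obtain ⟨P, hP, Q, hQ, hd, hp, hq⟩ := hp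
  have hcT : ∀ i, c i ∉ T := fun i => Finset.disjoint_left.1 h.disj (h.isCyc.apply_mem i)
  have hcC := h.isCyc.apply_mem
  have key : ∀ {i j k : ℕ} {P : Finset V}, PathOn G P (t i) (t j) k → P ⊆ T → c i ≠ c j →
      PathOn G ({c i} ∪ P ∪ {c j}) (c i) (c j) (k + 2) := by
    intro i j k P hp hP hij
    have := ((PathOn.nil (c i)).link (h.adj i) hp ?_).link (h.adj j).symm (.nil (c j)) ?_
    · simpa using this
    · simpa using fun h' => hcT i (hP h')
    · simpa using ⟨hij.symm, fun h' => hcT j (hP h')⟩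
  refine h.not_hasCycle (.of_ring (key hp hP h3) (key hq hQ h4) ?_ ?_ ?_ h1 h2 (by omega) (by omega))
  · grind
  · grind
  · rw [Finset.disjoint_left] at hd ⊢
    have := h1.ne
    have := h2.ne
    grind

theorem ne (h : Attached G T C L c t) {i j : ℕ} (hij : i ≠ j) (h1 : i < L) (h2 : j < L) :
    c i ≠ c j := by
  rcases hij.lt_or_gt with h' | h'
  · exact h.isCyc.apply_ne h' (by omega)
  · exact (h.isCyc.apply_ne h' (by omega)).symm

theorem length_one_mod (h : Attached G T C L c t) (h1 : L % 3 = 1) (h7 : 7 ≤ L) : False := by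
  have step : ∀ {c t : ℕ → V}, Attached G T C L c t → ∀ {n}, Joined G T (t 1) (t 3) n →
      n % 3 = 0 := by
    intro c t h n ⟨Q, hQ, hq⟩
    have r01 : ∀ n, Joined G T (t 0) (t 1) n → _ := fun n => h.ring (i := 0) one_pos (by omega)
    have r03 : ∀ n, Joined G T (t 0) (t 3) n → _ := fun n => h.ring (i := 0) three_pos (by omega)
    have r04 : ∀ n, Joined G T (t 0) (t 4) n → _ := fun n => h.ring (i := 0) four_pos (by omega)
    have r13 : ∀ n, Joined G T (t 1) (t 3) n → _ := fun n => h.ring (i := 1) two_pos (by omega)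
    have r14 : ∀ n, Joined G T (t 1) (t 4) n → _ := fun n => h.ring (i := 1) three_pos (by omega)
    have r34 : ∀ n, Joined G T (t 3) (t 4) n → _ := fun n => h.ring (i := 3) one_pos (by omega)
    have a1 := r13 _ ⟨Q, hQ, hq⟩
    rcases joined_or_bridge h.conn hQ hq (h.mem 0) (h.mem 4) with ⟨k, hk⟩ | hb | hb
    · have a2 := h.cross hk (h.isCyc.adj 0) (h.isCyc.adj' 3) (h.ne (by omega) (by omega) (by omega))
        (h.ne (by omega) (by omega) (by omega)) (h.ne (by omega) (by omega) (by omega))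
        (h.ne (by omega) (by omega) (by omega))
      obtain ⟨P, hP, -, -, -, hp, -⟩ := hk
      have a3 := r04 _ ⟨P, hP, hp⟩
      omega
    · obtain ⟨μ, ν, p, q, s, rfl, b1, b2, b3, b4, b5, -⟩ := hb
      have a2 := r01 _ b1
      have a3 := r03 _ b2
      have a4 := r14 _ b3.symm
      have a5 := r34 _ b4.symm
      have a6 := r04 _ b5
      omega
    · obtain ⟨μ, ν, p, q, s, rfl, b1, b2, b3, b4, b5, -⟩ := hb
      have a2 := r03 _ b1
      have a3 := r01 _ b2
      have a4 := r34 _ b3.symm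
      have a5 := r14 _ b4.symm
      have a6 := r04 _ b5
      omega
  have r01 : ∀ n, Joined G T (t 1) (t 2) n → _ := fun n => h.ring (i := 1) one_pos (by omega)
  have r12 : ∀ n, Joined G T (t 2) (t 3) n → _ := fun n => h.ring (i := 2) one_pos (by omega)
  have r23 : ∀ n, Joined G T (t 3) (t 4) n → _ := fun n => h.ring (i := 3) one_pos (by omega)
  have r03 : ∀ n, Joined G T (t 1) (t 4) n → _ := fun n => h.ring (i := 1) three_pos (by omega)
  have r02 : ∀ n, Joined G T (t 1) (t 3) n → _ := fun n => step h
  have r13 : ∀ n, Joined G T (t 2) (t 4) n → _ := fun n => step (h.shift 1)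
  obtain ⟨Q, hQ, n, hq⟩ := h.conn _ (h.mem 2) _ (h.mem 4)
  have a1 := r13 _ ⟨Q, hQ, hq⟩
  rcases joined_or_bridge h.conn hQ hq (h.mem 1) (h.mem 3) with ⟨k, hk⟩ | hb | hb
  · have a2 := h.cross hk (h.isCyc.adj 1) (h.isCyc.adj 3) (h.ne (by omega) (by omega) (by omega))
      (h.ne (by omega) (by omega) (by omega)) (h.ne (by omega) (by omega) (by omega))
      (h.ne (by omega) (by omega) (by omega))
    obtain ⟨P, hP, -, -, -, hp, -⟩ := hk
    have a3 := r02 _ ⟨P, hP, hp⟩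
    omega
  · obtain ⟨μ, ν, p, q, s, rfl, b1, b2, b3, b4, b5, -⟩ := hb
    have a2 := r01 _ b1
    have a3 := r03 _ b2
    have a4 := r12 _ b3.symm
    have a5 := r23 _ b4
    have a6 := r02 _ b5
    omega
  · obtain ⟨μ, ν, p, q, s, rfl, b1, b2, b3, b4, b5, -⟩ := hb
    have a2 := r03 _ b1
    have a3 := r01 _ b2
    have a4 := r23 _ b3
    have a5 := r12 _ b4.symm
    have a6 := r02 _ b5
    omega

theorem length_two_mod (h : Attached G T C L c t) (h2 : L % 3 = 2) (h5 : 5 ≤ L) : False := by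
  have r1 : ∀ i n, Joined G T (t i) (t (i + 1)) n → n % 3 ≠ 0 := fun i n hn => by
    have := h.ring one_pos (by omega) hn
    omega
  have r2 : ∀ i n, Joined G T (t i) (t (i + 2)) n → n % 3 = 0 := fun i n hn => by
    have := h.ring two_pos (by omega) hn
    omega
  have r3 : ∀ i n, Joined G T (t i) (t (i + 3)) n → n % 3 = 0 := fun i n hn => by
    have := h.ring three_pos (by omega) hn
    omega
  have hne : ∀ {i j}, i ≠ j → i < 5 → j < 5 → c i ≠ c j := fun h1 h2 h3 =>
    h.ne h1 (by omega) (by omega)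
  obtain ⟨Q, hQ, n, hq⟩ := h.conn _ (h.mem 1) _ (h.mem 2)
  have a1 := r1 1 _ ⟨Q, hQ, hq⟩
  rcases joined_or_bridge h.conn hQ hq (h.mem 0) (h.mem 3) with ⟨k, hk⟩ | hb | hb
  · rcases hk.reroute h.conn (h.mem 4) with ⟨n', hn⟩ | ⟨k', hk'⟩
    · have a2 := h.cross hn (h.isCyc.adj 0) (h.isCyc.adj 3) (hne (by omega) (by omega) (by omega))
        (hne (by omega) (by omega) (by omega)) (hne (by omega) (by omega) (by omega))
        (hne (by omega) (by omega) (by omega))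
      obtain ⟨P, hP, Q, hQ, -, hp, hq⟩ := hn
      have a3 := r3 0 _ ⟨P, hP, hp⟩
      have a4 := r3 1 _ ⟨Q, hQ, hq⟩
      omega
    · obtain ⟨p, q, r, s, μ, -, -, b1, b2, b3, b4⟩ := hk'.exists_link h.conn
      have a2 := r3 1 _ b1.symm
      have a3 := r2 2 _ b2.symm
      have a4 := r2 1 _ b3.symm
      have a5 := r1 2 _ b4.symm
      omega
  · obtain ⟨μ, ν, p, q, s, rfl, b1, b2, b3, b4, b5, -⟩ := hb
    have a2 := r1 0 _ b1
    have a3 := r2 0 _ b2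
    have a4 := r2 1 _ b3.symm
    have a5 := r1 2 _ b4.symm
    have a6 := r3 0 _ b5
    omega
  · obtain ⟨μ, ν, p, q, s, rfl, b1, b2, b3, b4, b5, b6⟩ := hb
    have a2 := r2 0 _ b1
    have a3 := r1 0 _ b2
    have a4 := r1 2 _ b3.symm
    have a5 := r2 1 _ b4.symm
    have a6 := r3 0 _ b5
    rcases Nat.eq_zero_or_pos q with rfl | hq
    · omega
    · have := h.cross (b6 hq).symm_right (h.isCyc.adj 0) (h.isCyc.adj 2)
        (hne (by omega) (by omega) (by omega)) (hne (by omega) (by omega) (by omega))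
        (hne (by omega) (by omega) (by omega)) (hne (by omega) (by omega) (by omega))
      omega

theorem length_eq_four (h : Attached G T C L c t) : L = 4 := by
  by_contra hL
  have h3 := h.isCyc.three_le
  have h0 : L % 3 ≠ 0 := fun h0 => h.not_hasCycle
    ((h.isCyc.hasCycle (by omega)).mono Finset.subset_union_left)
  have h12 : L % 3 = 1 ∨ L % 3 = 2 := by omega
  rcases h12 with h1 | h2
  · exact h.length_one_mod h1 (by omega)
  · exact h.length_two_mod h2 (by omega)

end Attached

/-- Disjoint paths in `T` from `u` to `A` and from `v` to `B`, meeting `C` only in `u` and `v`. -/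
def Linkage (G : SimpleGraph V) (T C A B : Finset V) (u v : V) : Prop :=
  ∃ S₁ ⊆ T, ∃ S₂ ⊆ T, Disjoint S₁ S₂ ∧ ∃ a ∈ A, ∃ b ∈ B, ∃ n m, PathOn G S₁ u a n ∧
    PathOn G S₂ v b m ∧ (∀ z ∈ S₁, z ∈ C → z = u) ∧ ∀ z ∈ S₂, z ∈ C → z = v

theorem Linkage.symm {T C A B : Finset V} {u v : V} (h : Linkage G T C A B u v) :
    Linkage G T C B A v u := by
  obtain ⟨S₁, h1, S₂, h2, hd, a, ha, b, hb, n, m, h3, h4, h5, h6⟩ := h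
  exact ⟨S₂, h2, S₁, h1, hd.symm, b, hb, a, ha, m, n, h4, h3, h6, h5⟩

theorem Linkage.exchange {T C A B K : Finset V} {u v w e : V} {k : ℕ}
    (h : Linkage G T C A B u v) (hwT : w ∈ T) (hwC : w ∈ C) (hu : w ≠ u) (hv : w ≠ v)
    (hK : K ⊆ insert w (T \ C)) (hp : PathOn G K w e k) (he : e ∈ A ∪ B) :
    Linkage G T C A B w v ∨ Linkage G T C A B u w := by
  obtain ⟨S₁, h1, S₂, h2, hd, a, ha, b, hb, n, m, h3, h4, h5, h6⟩ := h
  obtain ⟨M, hM, w', hw', y, hy, l, h7, -, h8⟩ := hp.exists_segment hK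
    (Finset.mem_singleton_self w) (Finset.mem_union_left (S₁ ∪ S₂) he)
  obtain rfl := Finset.mem_singleton.1 hw'
  rw [Finset.disjoint_left] at hd
  clear hp hK
  have hMT : M ⊆ T := by grind
  have hMC : ∀ z ∈ M, z ∈ C → z = w' := by grind
  have hw1 : w' ∉ S₁ := by grind
  have hw2 : w' ∉ S₂ := by grind
  have hyM := h7.right_mem
  by_cases hy1 : y ∈ S₁
  · left
    obtain ⟨R₁, R₂, p, q, b1, b2, rfl, b3, -⟩ := h3.split hy1
    have := b1.left_mem
    exact ⟨_, by grind, S₂, h2, by rw [Finset.disjoint_left]; grind, a, ha, b, hb, _, _,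
      h7.append b2 (by grind), h4, by grind, h6⟩
  by_cases hy2 : y ∈ S₂
  · right
    obtain ⟨R₁, R₂, p, q, b1, b2, rfl, b3, -⟩ := h4.split hy2
    have := b1.left_mem
    exact ⟨S₁, h1, _, by grind, by rw [Finset.disjoint_left]; grind, a, ha, b, hb, _, _, h3,
      h7.append b2 (by grind), h5, by grind⟩
  have hMd : ∀ z ∈ M, z ∉ S₁ ∧ z ∉ S₂ := by grind
  rcases Finset.mem_union.1 ((Finset.mem_union.1 hy).resolve_right (by simp [hy1, hy2])) with hA | hB
  · left
    exact ⟨M, hMT, S₂, h2, Finset.disjoint_left.2 fun z hz => (hMd z hz).2, y, hA, b, hb, _, _,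
      h7, h4, hMC, h6⟩
  · right
    exact ⟨S₁, h1, M, hMT, Finset.disjoint_right.2 fun z hz => (hMd z hz).1, a, ha, y, hB, _, _,
      h3, h7, h5, hMC⟩

/-- A path of length `n` in `T` from `u` to a hub, from which two further paths lead to `A` and
`B`, all meeting `C` only in `u`. -/
def Tripod (G : SimpleGraph V) (T C A B : Finset V) (u : V) (n : ℕ) : Prop :=
  ∃ h, ∃ M ⊆ T, ∃ S₁ ⊆ T, ∃ S₂ ⊆ T, ∃ a ∈ A, ∃ b ∈ B, ∃ p q, PathOn G M u h n ∧
    PathOn G S₁ h a p ∧ PathOn G S₂ h b q ∧ (∀ z ∈ S₁, z ∈ S₂ → z = h) ∧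
    (∀ z ∈ M, z ∈ S₁ ∪ S₂ → z = h) ∧ ∀ z ∈ M ∪ S₁ ∪ S₂, z ∈ C → z = u

theorem Tripod.symm {T C A B : Finset V} {u : V} {n : ℕ} (h : Tripod G T C A B u n) :
    Tripod G T C B A u n := by
  obtain ⟨h, M, hM, S₁, h1, S₂, h2, a, ha, b, hb, p, q, h3, h4, h5, h6, h7, h8⟩ := h
  exact ⟨h, M, hM, S₂, h2, S₁, h1, b, hb, a, ha, q, p, h3, h5, h4, by grind, by grind, by grind⟩

theorem Tripod.shorten_aux {T C A B M S₂ K : Finset V} {u h b m a : V} {n q k : ℕ}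
    (hM : M ⊆ T) (h2 : S₂ ⊆ T) (hb : b ∈ B) (h3 : PathOn G M u h n)
    (h5 : PathOn G S₂ h b q) (h7 : ∀ z ∈ M, z ∈ S₂ → z = h) (h8 : ∀ z ∈ M ∪ S₂, z ∈ C → z = u)
    (hK : K ⊆ T.erase h) (hp : PathOn G K m a k) (hm : m ∈ C ∪ M) (ha : a ∈ A)
    (hKX : ∀ z ∈ K, z ∈ C ∪ M → z = m) (hKS : Disjoint K S₂) :
    (∃ v ∈ C, Linkage G T C A B v u) ∨ ∃ n' < n, Tripod G T C A B u n' := by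
  rw [Finset.disjoint_left] at hKS
  have hmK := hp.left_mem
  have huM := h3.left_mem
  have hhM := h3.right_mem
  by_cases hmM : m ∈ M
  · right
    obtain ⟨R₁, R₂, r, s, b1, b2, rfl, b3, rfl⟩ := h3.split hmM
    have hs : 0 < s := b2.pos_of_ne (by grind)
    have := b1.left_mem
    have := b1.right_mem
    have := b2.left_mem
    have := b2.right_mem
    have hhu : h ∉ R₁ := fun h' => b2.ne_of_pos hs (b3 h h' b2.right_mem).symm
    refine ⟨r, by omega, m, R₁, by grind, K, by grind, _, ?_, a, ha, b, hb, k, _, b1, hp,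
      b2.append h5 (by grind), ?_, ?_, ?_⟩
    · grind
    · grind
    · grind
    · grind
  · left
    have hmC : m ∈ C := (Finset.mem_union.1 hm).resolve_right hmM
    refine ⟨m, hmC, K, by grind, _, ?_, ?_, a, ha, b, hb, k, _, hp, h3.append h5 h7, by grind,
      by grind⟩
    · grind
    · rw [Finset.disjoint_left]; grind

theorem Tripod.shorten {T C A B : Finset V} {u : V} {n : ℕ} (hC : 2 ≤ C.card)
    (hCT : C ⊆ T)
    (hN : ∀ z ∈ T, ∀ v ∈ T, v ≠ z → ∃ e ∈ A ∪ B, ∃ n, Joined G (T.erase z) v e n)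
    (h : Tripod G T C A B u n) :
    (∃ v ∈ C, Linkage G T C A B v u ∨ Linkage G T C A B u v) ∨ ∃ n' < n, Tripod G T C A B u n' := by
  obtain ⟨h, M, hM, S₁, h1, S₂, h2, a, ha, b, hb, p, q, h3, h4, h5, h6, h7, h8⟩ := h
  obtain ⟨v, hv, hvh⟩ := Finset.exists_mem_ne (s := C) (by omega) h
  have hh := hM h3.right_mem
  obtain ⟨e, he, k, P, hP, hp⟩ := hN h hh v (hCT hv) hvh
  have hPh : e ≠ h := (Finset.mem_erase.1 (hP hp.right_mem)).1
  obtain ⟨K, hK, m, hm, y, hy, l, c1, c2, c3⟩ := hp.exists_segment hP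
    (X := (C ∪ M).erase h) (Y := (A ∪ B ∪ S₁ ∪ S₂).erase h) (by simp [hvh, hv])
    (by simp at he; simp [hPh]; tauto)
  clear hp hP he hPh hN
  have hh1 := h4.left_mem
  have hh2 := h5.left_mem
  have hyK := c1.right_mem
  have hhK : h ∉ K := fun h' => (Finset.mem_erase.1 (hK h')).1 rfl
  have hm' := (Finset.mem_erase.1 hm).2
  have hKX : ∀ z ∈ K, z ∈ C ∪ M → z = m := fun z hz hz' =>
    c2 z hz (Finset.mem_erase.2 ⟨by rintro rfl; exact hhK hz, hz'⟩)
  have hKY : ∀ z ∈ K, z ∈ A ∪ B ∪ S₁ ∪ S₂ → z = y := fun z hz hz' =>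
    c3 z hz (Finset.mem_erase.2 ⟨by rintro rfl; exact hhK hz, hz'⟩)
  have hyh := (Finset.mem_erase.1 hy).1
  have hy' := (Finset.mem_erase.1 hy).2
  clear c2 c3 hm hy
  have toA : ∀ K' ⊆ T.erase h, ∀ a' ∈ A, ∀ k', PathOn G K' m a' k' →
      (∀ z ∈ K', z ∈ C ∪ M → z = m) → Disjoint K' S₂ →
      (∃ v ∈ C, Linkage G T C A B v u ∨ Linkage G T C A B u v) ∨
        ∃ n' < n, Tripod G T C A B u n' := by
    intro K' hK' a' ha' k' d1 d2 d3
    refine (Tripod.shorten_aux hM h2 hb h3 h5 (by grind) (by grind) hK' d1 hm' ha' d2 d3).imp ?_ id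
    rintro ⟨v, hv, h⟩
    exact ⟨v, hv, .inl h⟩
  have toB : ∀ K' ⊆ T.erase h, ∀ b' ∈ B, ∀ k', PathOn G K' m b' k' →
      (∀ z ∈ K', z ∈ C ∪ M → z = m) → Disjoint K' S₁ →
      (∃ v ∈ C, Linkage G T C A B v u ∨ Linkage G T C A B u v) ∨
        ∃ n' < n, Tripod G T C A B u n' := by
    intro K' hK' a' ha' k' d1 d2 d3
    refine (Tripod.shorten_aux hM h1 ha h3 h4 (by grind) (by grind) hK' d1 hm' ha' d2 d3).imp ?_ ?_
    · rintro ⟨v, hv, h⟩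
      exact ⟨v, hv, .inr h.symm⟩
    · rintro ⟨n', hn, h⟩
      exact ⟨n', hn, h.symm⟩
  have huM := h3.left_mem
  by_cases hy1 : y ∈ S₁
  · obtain ⟨R₁, R₂, r, s, b1, b2, rfl, b3, -⟩ := h4.split hy1
    have := b1.left_mem
    have hhR : h ∉ R₂ := fun h' => hyh (b3 h b1.left_mem h').symm
    refine toA _ ?_ a ha _ (c1.append b2 ?_) ?_ ?_
    · grind
    · grind
    · grind
    · rw [Finset.disjoint_left]; grind
  by_cases hy2 : y ∈ S₂
  · obtain ⟨R₁, R₂, r, s, b1, b2, rfl, b3, -⟩ := h5.split hy2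
    have := b1.left_mem
    have hhR : h ∉ R₂ := fun h' => hyh (b3 h b1.left_mem h').symm
    refine toB _ ?_ b hb _ (c1.append b2 ?_) ?_ ?_
    · grind
    · grind
    · grind
    · rw [Finset.disjoint_left]; grind
  by_cases hyA : y ∈ A
  · exact toA K hK y hyA _ c1 hKX (by rw [Finset.disjoint_left]; grind)
  · exact toB K hK y (by grind) _ c1 hKX (by rw [Finset.disjoint_left]; grind)

theorem Tripod.exists_linkage {T C A B : Finset V} {u : V} {n : ℕ} (hu : u ∈ C) (hC : 2 ≤ C.card)
    (hCT : C ⊆ T)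
    (hN : ∀ z ∈ T, ∀ v ∈ T, v ≠ z → ∃ e ∈ A ∪ B, ∃ n, Joined G (T.erase z) v e n)
    (h : Tripod G T C A B u n) : ∃ v ∈ C, ∃ w ∈ C, Linkage G T C A B v w := by
  induction n using Nat.strong_induction_on with
  | _ n ih =>
    rcases h.shorten hC hCT hN with ⟨v, hv, h | h⟩ | ⟨n', hn, h⟩
    · exact ⟨v, hv, u, hu, h⟩
    · exact ⟨u, hu, v, hv, h⟩
    · exact ih n' hn h

theorem exists_linkage {T C A B : Finset V} (hT : Conn G T) (hC : 2 ≤ C.card)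
    (hCT : C ⊆ T) (hA : A ⊆ T) (hB : B ⊆ T) (hAne : A.Nonempty) (hBne : B.Nonempty)
    (hN : ∀ z ∈ T, ∀ v ∈ T, v ≠ z → ∃ e ∈ A ∪ B, ∃ n, Joined G (T.erase z) v e n) :
    ∃ v ∈ C, ∃ w ∈ C, Linkage G T C A B v w := by
  obtain ⟨b, hb⟩ := hBne
  obtain ⟨a, ha⟩ := hAne
  obtain ⟨c, hc⟩ := Finset.card_pos.1 (by omega : 0 < C.card)
  obtain ⟨P, hP, n, hp⟩ := hT c (hCT hc) a (hA ha)
  obtain ⟨S, hS, u, hu, a, ha, n, h1, h2, -⟩ := hp.exists_segment hP hc ha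
  obtain ⟨P, hP, k, hp⟩ := hT b (hB hb) u (hCT hu)
  obtain ⟨K, hK, b', hb', e, he, k, h3, -, h4⟩ := hp.exists_segment hP
    (Finset.mem_singleton_self b) (Finset.mem_union_left S hu)
  obtain rfl := Finset.mem_singleton.1 hb'
  have heK := h3.right_mem
  by_cases heS : e ∈ S
  · obtain ⟨R₁, R₂, r, s, b1, b2, rfl, b3, -⟩ := h1.split heS
    have := b1.left_mem
    refine Tripod.exists_linkage (n := r) hu hC hCT hN
      ⟨e, R₁, by grind, R₂, by grind, K, hK, a, ha, b', hb, _, _, b1, b2, h3.symm, ?_, ?_, ?_⟩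
    · grind
    · grind
    · grind
  · have heC : e ∈ C := (Finset.mem_union.1 he).resolve_right heS
    exact ⟨u, hu, e, heC, S, hS, K, hK, by rw [Finset.disjoint_left]; grind, a, ha, b', hb, _, _, h1,
      h3.symm, h2, by grind⟩

theorem Linkage.two_mul_mod {T C A B : Finset V} {L : ℕ} {c : ℕ → V} (hC : IsCyc G C L c)
    (hCT : C ⊆ T) (hAB : ∀ a ∈ A, ∀ b ∈ B, ∀ n, Joined G T a b n → n % 3 = 2) {i d : ℕ}
    (hd : d < L) (h : Linkage G T C A B (c i) (c (i + d))) : 0 < d ∧ 2 * d % 3 = L % 3 := by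
  obtain ⟨S₁, h1, S₂, h2, hdis, a, ha, b, hb, n, m, h3, h4, h5, h6⟩ := h
  rw [Finset.disjoint_left] at hdis
  have hpos : 0 < d := by
    rcases Nat.eq_zero_or_pos d with rfl | h
    · exact absurd h4.left_mem (hdis h3.left_mem)
    · exact h
  have key : ∀ R ⊆ C, ∀ k, PathOn G R (c i) (c (i + d)) k → (n + k + m) % 3 = 2 := by
    intro R hR k hp
    refine hAB a ha b hb _ ⟨_, ?_, (h3.symm.append hp ?_).append h4 ?_⟩
    · grind
    · grind
    · have := hp.right_mem
      grind
  have hsub : ∀ j e, ((Finset.range e).image fun k => c (j + k)) ⊆ C := by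
    intro j e z hz
    obtain ⟨k, -, rfl⟩ := Finset.mem_image.1 hz
    exact hC.apply_mem _
  have k1 := key _ (hsub _ _) _ (hC.arc i hd)
  have h7 := hC.arc (i + d) (d := L - d) (by omega)
  rw [show i + d + (L - d) = i + L by omega, hC.apply_add_self] at h7
  have k2 := key _ (hsub _ _) _ h7.symm
  omega

theorem not_two_mod {T C A B : Finset V} {L : ℕ} {c : ℕ → V} (hT : Conn G T)
    (hC : IsCyc G C L c) (hL : ¬3 ∣ L)
    (hCT : C ⊆ T) (hA : A ⊆ T) (hB : B ⊆ T) (hAne : A.Nonempty) (hBne : B.Nonempty)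
    (hN : ∀ z ∈ T, ∀ v ∈ T, v ≠ z → ∃ e ∈ A ∪ B, ∃ n, Joined G (T.erase z) v e n)
    (hatt : ∀ i, 0 < i → i < L → ∃ e ∈ A ∪ B, ∃ n, Joined G (insert (c i) (T \ C)) (c i) e n) :
    ¬∀ a ∈ A, ∀ b ∈ B, ∀ n, Joined G T a b n → n % 3 = 2 := by
  intro hAB
  have h3 := hC.three_le
  have hBA : ∀ b ∈ B, ∀ a ∈ A, ∀ n, Joined G T b a n → n % 3 = 2 :=
    fun b hb a ha n h => hAB a ha b hb n h.symm
  set P : ℕ → ℕ → Prop := fun i j => Linkage G T C A B (c i) (c j) with hP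
  have special : ∀ i j, i < L → j < L → P i j →
      (i < j ∧ 2 * (j - i) % 3 = L % 3) ∨ (j < i ∧ 2 * (i - j) % 3 = L % 3) := by
    intro i j hi hj h
    rcases le_or_gt i j with hij | hij
    · have := Linkage.two_mul_mod (d := j - i) (i := i) hC hCT hAB (by omega)
        (by rwa [Nat.add_sub_cancel' hij])
      omega
    · have := Linkage.two_mul_mod (d := i - j) (i := j) hC hCT hBA (by omega)
        (by rw [Nat.add_sub_cancel' hij.le]; exact h.symm)
      omega
  have hne : ∀ i j, i < L → j < L → i ≠ j → c i ≠ c j := by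
    intro i j hi hj hij
    rcases hij.lt_or_gt with h | h
    · exact hC.apply_ne h (by omega)
    · exact (hC.apply_ne h (by omega)).symm
  have exch : ∀ i j k, i < L → j < L → 0 < k → k < L → k ≠ i → k ≠ j → P i j → P k j ∨ P i k := by
    intro i j k hi hj hk0 hk hki hkj h
    obtain ⟨e, he, n, K, hK, hp⟩ := hatt k hk0 hk
    exact h.exchange (hCT (hC.apply_mem _)) (hC.apply_mem _) (hne _ _ hk hi hki)
      (hne _ _ hk hj hkj) hK hp he
  have exch' : ∀ i j k, i < L → j < L → 0 < k → k < L → k ≠ i → k ≠ j → P i j ∨ P j i →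
      (P k j ∨ P j k) ∨ (P k i ∨ P i k) := by
    intro i j k hi hj hk0 hk hki hkj h
    rcases h with h | h
    · have := exch i j k hi hj hk0 hk hki hkj h
      tauto
    · have := exch j i k hj hi hk0 hk hkj hki h
      tauto
  have special' : ∀ i j, i < L → j < L → P i j ∨ P j i →
      (i < j ∧ 2 * (j - i) % 3 = L % 3) ∨ (j < i ∧ 2 * (i - j) % 3 = L % 3) := by
    intro i j hi hj h
    rcases h with h | h
    · exact special i j hi hj h
    · exact (special j i hj hi h).symm
  have good : ∀ i j k, i < L → j < L → 0 < k → k < L → k ≠ i → k ≠ j →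
      ¬((i < k ∧ 2 * (k - i) % 3 = L % 3) ∨ (k < i ∧ 2 * (i - k) % 3 = L % 3)) →
      ¬((j < k ∧ 2 * (k - j) % 3 = L % 3) ∨ (k < j ∧ 2 * (j - k) % 3 = L % 3)) →
      ¬(P i j ∨ P j i) := by
    intro i j k hi hj hk0 hk hki hkj h1 h2 h
    rcases exch' i j k hi hj hk0 hk hki hkj h with h | h
    · exact h2 (special' k j hk hj h).symm
    · exact h1 (special' k i hk hi h).symm
  have lt : ∀ i j, i < j → j < L → ¬(P i j ∨ P j i) := by
    intro i j hij hj h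
    have hs := special' i j (by omega) hj h
    have h12 : L % 3 = 1 ∨ L % 3 = 2 := by omega
    rcases h12 with hL1 | hL2
    · exact good i j (i + 1) (by omega) hj (by omega) (by omega) (by omega) (by omega) (by omega)
        (by omega) h
    by_cases h4 : 4 ≤ j - i
    · exact good i j (i + 2) (by omega) hj (by omega) (by omega) (by omega) (by omega) (by omega)
        (by omega) h
    obtain rfl : j = i + 1 := by omega
    by_cases hi : i + 3 < L
    · exact good i (i + 1) (i + 3) (by omega) hj (by omega) (by omega) (by omega) (by omega)
        (by omega) (by omega) h
    by_cases hi' : 3 ≤ i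
    · exact good i (i + 1) (i - 2) (by omega) hj (by omega) (by omega) (by omega) (by omega)
        (by omega) (by omega) h
    obtain ⟨rfl, rfl⟩ : i = 2 ∧ L = 5 := by omega
    rcases exch' 2 3 1 (by omega) (by omega) (by omega) (by omega) (by omega) (by omega) h with h | h
    · have := special' 1 3 (by omega) (by omega) h
      omega
    · exact good 1 2 4 (by omega) (by omega) (by omega) (by omega) (by omega) (by omega) (by omega)
        (by omega) h
  obtain ⟨v, hv, w, hw, h⟩ := exists_linkage hT (by rw [hC.card_eq]; omega) hCT hA hB hAne hBne hN
  have hidx : ∀ v ∈ C, ∃ i < L, c i = v := by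
    intro v hv
    obtain ⟨i, rfl⟩ := (hC.mem v).1 hv
    exact ⟨i % L, Nat.mod_lt _ (by omega), (hC.inj _ _).2 (Nat.mod_modEq _ _)⟩
  obtain ⟨i, hi, rfl⟩ := hidx v hv
  obtain ⟨j, hj, rfl⟩ := hidx w hw
  have hs := special i j hi hj h
  rcases hs with hs | hs
  · exact lt i j hs.1 hj (.inl h)
  · exact lt j i hs.1 hi (.inr h)

theorem Attached.length_mod {T C : Finset V} {L : ℕ} {c t : ℕ → V} (h : Attached G T C L c t)
    {i d n : ℕ} {u w : V} (h0 : 0 < d) (hd : d < L) (hu : u ∈ T) (hw : w ∈ T)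
    (hiu : G.Adj u (c i)) (hdw : G.Adj w (c (i + d))) (hp : Joined G T u w n) :
    ¬3 ∣ n + d + 2 ∧ ¬3 ∣ n + (L - d) + 2 := by
  have h' : Attached G T C L c fun j => if j = i then u else if j = i + d then w else t j := by
    refine ⟨h.isCyc, h.conn, h.disj, fun j => ?_, fun j => ?_, h.not_hasCycle⟩
    · split_ifs
      · exact hu
      · exact hw
      · exact h.mem j
    · split_ifs with h1 h2
      · exact h1 ▸ hiu.symm
      · exact h2 ▸ hdw.symm
      · exact h.adj j
  refine h'.ring (i := i) h0 hd ?_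
  simpa [h0.ne'] using hp

theorem IsCyc.conn {C : Finset V} {L : ℕ} {c : ℕ → V} (h : IsCyc G C L c) : Conn G C := by
  have h3 := h.three_le
  have key : ∀ i, ∃ S ⊆ C, ∃ n, PathOn G S (c 0) (c i) n := by
    intro i
    have := h.arc 0 (d := i % L) (Nat.mod_lt _ (by omega))
    rw [zero_add, (h.inj _ _).2 (Nat.mod_modEq i L)] at this
    refine ⟨_, ?_, _, this⟩
    intro z hz
    obtain ⟨k, -, rfl⟩ := Finset.mem_image.1 hz
    exact h.apply_mem _
  intro u hu v hv
  obtain ⟨i, rfl⟩ := (h.mem u).1 hu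
  obtain ⟨j, rfl⟩ := (h.mem v).1 hv
  obtain ⟨S₁, h1, n, hn⟩ := key i
  obtain ⟨S₂, h2, m, hm⟩ := key j
  obtain ⟨S, hS, k, hk⟩ := hn.symm.exists_trans hm
  exact ⟨S, hS.trans (Finset.union_subset h1 h2), k, hk⟩

/-- A critical set split into a `4`-cycle `c` and a connected set `T`, where `A` and `B` are the
sets of neighbours in `T` of the two pairs of opposite vertices of the cycle. -/
structure Frame (G : SimpleGraph V) (S : Finset V) (x : V) (T A B : Finset V) (c : ℕ → V) :
    Prop where
  crit : Crit G S x
  sub : T ⊆ S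
  x_mem : x ∈ T
  conn : Conn G T
  cyc : IsCyc G (S \ T) 4 c
  mem_left : ∀ v, v ∈ A ↔ v ∈ T ∧ (G.Adj v (c 0) ∨ G.Adj v (c 2))
  mem_right : ∀ v, v ∈ B ↔ v ∈ T ∧ (G.Adj v (c 1) ∨ G.Adj v (c 3))
  left_ne : A.Nonempty
  right_ne : B.Nonempty
  mod : ∀ a ∈ A, ∀ b ∈ B, ∀ n, Joined G T a b n → n % 3 = 2

theorem Crit.exists_frame {S : Finset V} {x : V} (h : Crit G S x) :
    ∃ T A B c, Frame G S x T A B c := by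
  classical
  have hcore : Core G (S \ {x}) := by
    rw [Finset.sdiff_singleton_eq_erase]
    refine ⟨_, subset_rfl, ?_, ?_⟩
    · obtain ⟨y, hy, hxy⟩ := exists_adj (lt_of_lt_of_le two_pos h.two_le)
      exact ⟨y, Finset.mem_erase.2 ⟨hxy.ne', hy⟩⟩
    · intro v hv
      have h1 := h.three_le v (Finset.mem_erase.1 hv).2 (Finset.mem_erase.1 hv).1
      have := le_deg_erase_add_one (G := G) S x v
      omega
  have hconn : Conn G {x} := by
    intro u hu v hv
    obtain rfl := Finset.mem_singleton.1 hu
    obtain rfl := Finset.mem_singleton.1 hv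
    exact ⟨_, subset_rfl, 0, .nil _⟩
  obtain ⟨T, hxT, hT, hTc, L, c, hc, hatt⟩ :=
    h.exists_isCyc (by simpa using h.mem) (Finset.singleton_nonempty x) hconn hcore
  have hx : x ∈ T := hxT (Finset.mem_singleton_self x)
  have hatt' : ∀ i, ∃ t ∈ T, G.Adj (c i) t := fun i =>
    hatt _ (hc.apply_mem i) fun he => (Finset.mem_sdiff.1 (hc.apply_mem i)).2 (he ▸ hx)
  choose t ht htc using hatt'
  have hA : Attached G T (S \ T) L c t :=
    ⟨hc, hTc, Finset.sdiff_disjoint, ht, htc, by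
      rw [Finset.sdiff_union_of_subset hT]; exact h.not_hasCycle⟩
  obtain rfl := hA.length_eq_four
  refine ⟨T, T.filter fun v => G.Adj v (c 0) ∨ G.Adj v (c 2),
    T.filter fun v => G.Adj v (c 1) ∨ G.Adj v (c 3), c, h, hT, hx, hTc, hc, fun v => by simp,
    fun v => by simp, ⟨t 0, by simp [ht, (htc 0).symm]⟩, ⟨t 1, by simp [ht, (htc 1).symm]⟩, ?_⟩
  intro a ha b hb n hn
  rw [Finset.mem_filter] at ha hb
  obtain ⟨ha, ha0 | ha2⟩ := ha <;> obtain ⟨hb, hb1 | hb3⟩ := hb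
  · have := hA.length_mod (i := 0) (d := 1) (by omega) (by omega) ha hb ha0 hb1 hn
    omega
  · have := hA.length_mod (i := 0) (d := 3) (by omega) (by omega) ha hb ha0 hb3 hn
    omega
  · have := hA.length_mod (i := 1) (d := 1) (by omega) (by omega) hb ha hb1 ha2 hn.symm
    omega
  · have := hA.length_mod (i := 2) (d := 1) (by omega) (by omega) ha hb ha2 hb3 hn
    omega

namespace Frame

variable {S T A B : Finset V} {x : V} {c : ℕ → V}

theorem symm (h : Frame G S x T A B c) : Frame G S x T B A fun i => c (1 + i) where
  crit := h.crit
  sub := h.sub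
  x_mem := h.x_mem
  conn := h.conn
  cyc := h.cyc.shift 1
  mem_left := h.mem_right
  mem_right v := by
    have : c (1 + 3) = c 0 := h.cyc.apply_add_self 0
    rw [h.mem_left, this]
    tauto
  left_ne := h.right_ne
  right_ne := h.left_ne
  mod a ha b hb n hn := h.mod b hb a ha n hn.symm

theorem left_sub (h : Frame G S x T A B c) : A ⊆ T := fun v hv => ((h.mem_left v).1 hv).1

theorem mem_cyc (h : Frame G S x T A B c) {v : V} (hv : v ∈ S \ T) :
    v = c 0 ∨ v = c 1 ∨ v = c 2 ∨ v = c 3 := by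
  obtain ⟨i, rfl⟩ := (h.cyc.mem v).1 hv
  have h1 : c i = c (i % 4) := (h.cyc.inj _ _).2 (Nat.mod_modEq _ _).symm
  have h2 : i % 4 = 0 ∨ i % 4 = 1 ∨ i % 4 = 2 ∨ i % 4 = 3 := by omega
  rw [h1]
  rcases h2 with h | h | h | h <;> simp [h]

theorem mem_union (h : Frame G S x T A B c) {v w : V} (hv : v ∈ T) (hw : w ∈ S \ T)
    (hvw : G.Adj v w) : v ∈ A ∪ B := by
  rw [Finset.mem_union, h.mem_left, h.mem_right]
  rcases h.mem_cyc hw with rfl | rfl | rfl | rfl <;> tauto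

theorem notMem_right (h : Frame G S x T A B c) {v : V} (hv : v ∈ A) : v ∉ B := fun hv' => by
  have := h.mod v hv v hv' 0 ⟨{v}, by simpa using h.left_sub hv, .nil v⟩
  omega

theorem not_adj (h : Frame G S x T A B c) {v w : V} (hv : v ∈ A) (hw : w ∈ B) : ¬G.Adj v w := by
  intro hvw
  have := h.mod v hv w hw 1 ⟨{v, w}, by
    intro z hz
    simp only [Finset.mem_insert, Finset.mem_singleton] at hz
    rcases hz with rfl | rfl
    · exact h.left_sub hv
    · exact h.symm.left_sub hw, .of_adj hvw⟩
  omega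

theorem exists_joined_erase (h : Frame G S x T A B c) {z v : V} (hz : z ∈ T) (hv : v ∈ T)
    (hvz : v ≠ z) : ∃ e ∈ A ∪ B, ∃ n, Joined G (T.erase z) v e n := by
  classical
  by_contra! hno
  set K := (T.erase z).filter fun w => ∃ n, Joined G (T.erase z) v w n with hK
  have hvK : v ∈ K := by
    rw [hK, Finset.mem_filter]
    exact ⟨Finset.mem_erase.2 ⟨hvz, hv⟩, 0, {v}, by simp [hvz, hv], .nil v⟩
  have hKT : K ⊆ T := (Finset.filter_subset _ _).trans (Finset.erase_subset _ _)
  have hzK : z ∉ K := by simp [hK]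
  have hR : insert z K ⊆ T := Finset.insert_subset hz hKT
  obtain ⟨b, hb, hbz, t, ht, hbt⟩ := h.crit.bdry (insert z K) (hR.trans h.sub)
    (fun he => (Finset.mem_sdiff.1 (h.cyc.apply_mem 0)).2
      (hR (he ▸ (Finset.mem_sdiff.1 (h.cyc.apply_mem 0)).1)))
    (by rw [Finset.card_insert_of_notMem hzK]; have := Finset.card_pos.2 ⟨v, hvK⟩; omega) z
  have hbK := (Finset.mem_insert.1 hb).resolve_left hbz
  obtain ⟨hbT, n, hn⟩ := Finset.mem_filter.1 hbK
  obtain ⟨htS, htR⟩ := Finset.mem_sdiff.1 ht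
  by_cases htT : t ∈ T
  · apply htR
    have htz : t ≠ z := by rintro rfl; exact htR (Finset.mem_insert_self _ _)
    have htT' : t ∈ T.erase z := Finset.mem_erase.2 ⟨htz, htT⟩
    refine Finset.mem_insert_of_mem (Finset.mem_filter.2 ⟨htT', ?_⟩)
    obtain ⟨P, hP, hp⟩ := hn
    obtain ⟨Q, hQ, k, hk⟩ := hp.exists_trans (.of_adj hbt)
    exact ⟨k, Q, by grind, hk⟩
  · exact hno b (h.mem_union (hKT hbK) (Finset.mem_sdiff.2 ⟨htS, htT⟩) hbt) n hn

theorem not_core (h : Frame G S x T A B c) : ¬Core G T := by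
  intro hcore
  have hTS : S \ (S \ T) = T := Finset.sdiff_sdiff_eq_self h.sub
  obtain ⟨U, hU, hUS, hUc, L, c', hc', hatt⟩ := h.crit.exists_isCyc Finset.sdiff_subset
    ⟨_, h.cyc.apply_mem 0⟩ h.cyc.conn (by rwa [hTS])
  have hCT : S \ U ⊆ T := by
    rw [← hTS]
    exact Finset.sdiff_subset_sdiff subset_rfl hU
  have hL : ¬3 ∣ L := fun h3 =>
    h.crit.not_hasCycle ((hc'.hasCycle h3).mono Finset.sdiff_subset)
  have hatt' : ∀ v ∈ S \ U, v ≠ x →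
      ∃ e ∈ A ∪ B, ∃ n, Joined G (insert v (T \ (S \ U))) v e n := by
    intro v hv hvx
    obtain ⟨t, ht, hvt⟩ := hatt v hv hvx
    obtain ⟨P, hP, n, hp⟩ := hUc t ht _ (hU (h.cyc.apply_mem 0))
    obtain ⟨M, hM, t', ht', e, he, m, h1, -, h2⟩ := hp.exists_segment hP
      (Finset.mem_singleton_self t) (h.cyc.apply_mem 0)
    obtain rfl := Finset.mem_singleton.1 ht'
    rcases m with _ | m
    · obtain ⟨rfl, -⟩ := h1.eq_of_length_zero
      exact ⟨v, h.mem_union (hCT hv) he hvt, 0, {v}, by simp, .nil v⟩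
    · obtain ⟨w, M', h3, h4, rfl, h5⟩ := h1.unsnoc
      have hvM : v ∉ M' := by grind
      have hM' : M' ⊆ T \ (S \ U) := by grind
      have hwT := (Finset.mem_sdiff.1 (hM' h5.right_mem)).1
      exact ⟨w, h.mem_union hwT he h3, _, _, Finset.insert_subset_insert _ hM',
        .cons hvt hvM h5⟩
  obtain ⟨k, hk⟩ : ∃ k, ∀ i, 0 < i → i < L → c' (k + i) ≠ x := by
    by_cases hx : x ∈ S \ U
    · obtain ⟨k, rfl⟩ := (hc'.mem x).1 hx
      exact ⟨k, fun i h0 hi => (hc'.apply_ne (by omega) (by omega)).symm⟩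
    · exact ⟨0, fun i _ _ he => hx (he ▸ hc'.apply_mem _)⟩
  exact not_two_mod h.conn (hc'.shift k) hL hCT h.left_sub h.symm.left_sub h.left_ne h.right_ne
    (fun z hz v hv hvz => h.exists_joined_erase hz hv hvz)
    (fun i h0 hi => hatt' _ (hc'.apply_mem _) (hk i h0 hi)) h.mod

theorem deg_eq (h : Frame G S x T A B c) (v : V) : deg G S v = deg G T v + deg G (S \ T) v := by
  rw [← deg_union Finset.disjoint_sdiff, Finset.union_sdiff_of_subset h.sub]

theorem leaf (h : Frame G S x T A B c) {u : V} (hu : u ∈ T) (hux : u ≠ x) (hd : deg G T u ≤ 1) :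
    (u ∈ A ∧ G.Adj u (c 0) ∧ G.Adj u (c 2)) ∨ (u ∈ B ∧ G.Adj u (c 1) ∧ G.Adj u (c 3)) := by
  have h1 := h.crit.three_le u (h.sub hu) hux
  rw [h.deg_eq] at h1
  have key : ∀ {A B : Finset V} {c : ℕ → V}, Frame G S x T A B c → u ∈ A →
      u ∈ A ∧ G.Adj u (c 0) ∧ G.Adj u (c 2) := by
    intro A B c h huA
    have hB := fun h' => h.notMem_right huA ((h.mem_right u).2 ⟨hu, h'⟩)
    have hsub : ∀ w ∈ S \ T, G.Adj u w → w = c 0 ∨ w = c 2 := by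
      intro w hw huw
      rcases h.mem_cyc hw with rfl | rfl | rfl | rfl <;> tauto
    refine ⟨huA, ?_, ?_⟩
    · obtain ⟨w, hw, huw, hwn⟩ := exists_adj_notMem (G := G) (S := S \ T) (F := {c 2}) (v := u)
        (by simp; omega)
      rcases hsub w hw huw with rfl | rfl
      · exact huw
      · simp at hwn
    · obtain ⟨w, hw, huw, hwn⟩ := exists_adj_notMem (G := G) (S := S \ T) (F := {c 0}) (v := u)
        (by simp; omega)
      rcases hsub w hw huw with rfl | rfl
      · simp at hwn
      · exact huw
  obtain ⟨w, hw, huw⟩ := exists_adj (G := G) (S := S \ T) (v := u) (by omega)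
  rcases Finset.mem_union.1 (h.mem_union hu hw huw) with hA | hB
  · exact .inl (key h hA)
  · exact .inr (key h.symm hB)

theorem notMem_left_of_adj (h : Frame G S x T A B c) {u w : V} (hu : u ∈ T) (h0 : G.Adj u (c 0))
    (h2 : G.Adj u (c 2)) (huw : G.Adj u w) : w ∉ A := by
  intro hw
  obtain ⟨hwT, hw⟩ := (h.mem_left w).1 hw
  have key : ∀ i, G.Adj u (c i) → G.Adj w (c i) → False := by
    intro i h1 h2
    refine h.crit.not_hasCycle (.of_ring (S := {u, w}) (S' := {c i}) (.of_adj huw) (.nil (c i))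
      ?_ ?_ ?_ h1 h2 (by omega) (by omega))
    · have := h.sub hu
      have := h.sub hwT
      grind
    · have := h.cyc.apply_mem i
      grind
    · have := h.cyc.apply_mem i
      rw [Finset.disjoint_left]
      grind
  rcases hw with hw | hw
  · exact key 0 h0 hw
  · exact key 2 h2 hw

theorem leaf_nbr (h : Frame G S x T A B c) {u w : V} (hu : u ∈ T) (hux : u ≠ x)
    (hd : deg G T u ≤ 1) (huw : G.Adj u w) : w ∉ A ∪ B := by
  rw [Finset.mem_union]
  rcases h.leaf hu hux hd with ⟨hA, h0, h2⟩ | ⟨hB, h1, h3⟩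
  · exact fun hw => hw.elim (h.notMem_left_of_adj hu h0 h2 huw) fun hw => h.not_adj hA hw huw
  · exact fun hw => hw.elim (fun hw => h.not_adj hw hB huw.symm)
      (h.symm.notMem_left_of_adj hu h1 h3 huw)

theorem not_leaf_leaf (h : Frame G S x T A B c) {u u' : V} (hu : u ∈ T) (hu' : u' ∈ T)
    (huu' : u ≠ u') (h0 : G.Adj u (c 0)) (h2 : G.Adj u (c 2)) (h1 : G.Adj u' (c 1))
    (h3 : G.Adj u' (c 3)) : False := by
  have e1 := (PathOn.of_adj h0).symm.append (.of_adj h2) (by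
    have := h.cyc.apply_ne (i := 0) (j := 2) (by omega) (by omega)
    grind)
  have e2 := (PathOn.of_adj h3).symm.append (.of_adj h1) (by
    have := h.cyc.apply_ne (i := 1) (j := 3) (by omega) (by omega)
    grind)
  have a30 : G.Adj (c 0) (c 3) := by
    have := h.cyc.adj' 3
    rwa [show c (3 + 1) = c 0 from h.cyc.apply_add_self 0] at this
  have m0 := Finset.mem_sdiff.1 (h.cyc.apply_mem 0)
  have m1 := Finset.mem_sdiff.1 (h.cyc.apply_mem 1)
  have m2 := Finset.mem_sdiff.1 (h.cyc.apply_mem 2)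
  have m3 := Finset.mem_sdiff.1 (h.cyc.apply_mem 3)
  have n1 := h.sub hu
  have n2 := h.sub hu'
  refine h.crit.not_hasCycle (.of_ring e1 e2 ?_ ?_ ?_ a30 (h.cyc.adj' 1) (by omega) (by omega))
  · grind
  · grind
  · have := h.cyc.apply_ne (i := 0) (j := 1) (by omega) (by omega)
    have := h.cyc.apply_ne (i := 0) (j := 3) (by omega) (by omega)
    have := h.cyc.apply_ne (i := 1) (j := 2) (by omega) (by omega)
    have := h.cyc.apply_ne (i := 2) (j := 3) (by omega) (by omega)
    rw [Finset.disjoint_left]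
    grind

theorem not_two_leaves (h : Frame G S x T A B c) {u u' w : V} (hu : u ∈ T) (hu' : u' ∈ T)
    (hw : w ∈ T) (huu' : u ≠ u') (h1 : G.Adj u w) (h1' : G.Adj u' w) (h0 : G.Adj u (c 0))
    (h2 : G.Adj u' (c 2)) : False := by
  have e1 := (PathOn.of_adj h1).append (PathOn.of_adj h1').symm (by grind)
  have n1 := h.sub hu
  have n2 := h.sub hu'
  have n3 := h.sub hw
  have hcT : ∀ z ∈ (Finset.range 3).image fun k => c (0 + k), z ∈ S ∧ z ∉ T := by
    intro z hz
    obtain ⟨k, -, rfl⟩ := Finset.mem_image.1 hz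
    exact Finset.mem_sdiff.1 (h.cyc.apply_mem _)
  refine h.crit.not_hasCycle (.of_ring e1 (h.cyc.arc 0 (d := 2) (by omega)) ?_
    (fun z hz => (hcT z hz).1) ?_ h0 h2 (by omega) (by omega))
  · grind
  · rw [Finset.disjoint_left]
    intro z hz hz'
    have := (hcT z hz').2
    grind

theorem false (h : Frame G S x T A B c) : False := by
  classical
  have hnc := h.not_core
  set T' := T.filter fun v => v = x ∨ 2 ≤ deg G T v with hT'
  have hTT : T' ⊆ T := Finset.filter_subset _ _
  have hxT' : x ∈ T' := by simp [hT', h.x_mem]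
  have hleaf : ∀ v ∈ T, v ∉ T' → v ≠ x ∧ deg G T v ≤ 1 := by
    intro v hv hv'
    simp only [hT', Finset.mem_filter, hv, true_and, not_or] at hv'
    exact ⟨hv'.1, by omega⟩
  have hdiff : ∀ u ∈ T, ∀ u' ∈ T, u ∉ T' → u' ∉ T' → u ∈ A → u' ∈ B → False := by
    intro u hu u' hu' h1 h2 huA huB
    rcases h.leaf hu (hleaf u hu h1).1 (hleaf u hu h1).2 with ⟨-, a0, a2⟩ | ⟨h', -, -⟩
    · rcases h.leaf hu' (hleaf u' hu' h2).1 (hleaf u' hu' h2).2 with ⟨h', -, -⟩ | ⟨-, a1, a3⟩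
      · exact h.notMem_right h' huB
      · exact h.not_leaf_leaf hu hu' (by rintro rfl; exact h.notMem_right huA huB) a0 a2 a1 a3
    · exact h.notMem_right huA h'
  by_cases hone : T' ⊆ {x}
  · have hnot : ∀ v ∈ T, v ≠ x → v ∉ T' := fun v _ hvx hv => hvx (by simpa using hone hv)
    obtain ⟨a, ha⟩ := h.left_ne
    obtain ⟨b, hb⟩ := h.right_ne
    have haT := h.left_sub ha
    have hbT := h.symm.left_sub hb
    have hab : a ≠ b := by rintro rfl; exact h.notMem_right ha hb
    have hxAB : x ∉ A ∪ B := by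
      obtain ⟨u, hu, hux⟩ : ∃ u ∈ T, u ≠ x := by
        by_cases hax : a = x
        · exact ⟨b, hbT, by rintro rfl; exact hab hax⟩
        · exact ⟨a, haT, hax⟩
      have hdu := (hleaf u hu (hnot u hu hux)).2
      obtain ⟨P, hP, n, hp⟩ := h.conn u hu x h.x_mem
      obtain ⟨m, rfl⟩ : ∃ m, n = m + 1 := ⟨n - 1, by have := hp.pos_of_ne hux; omega⟩
      obtain ⟨w, P', huw, -, rfl, hp'⟩ := hp.uncons
      have hwT : w ∈ T := hP (Finset.mem_insert_of_mem hp'.left_mem)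
      have hw := h.leaf_nbr hu hux hdu huw
      by_cases hwx : w = x
      · exact hwx ▸ hw
      · have := h.leaf hwT hwx (hleaf w hwT (hnot w hwT hwx)).2
        rw [Finset.mem_union] at hw
        tauto
    rw [Finset.mem_union, not_or] at hxAB
    exact hdiff a haT b hbT (hnot a haT (by rintro rfl; exact hxAB.1 ha))
      (hnot b hbT (by rintro rfl; exact hxAB.2 hb)) ha hb
  · have hw : ∃ w ∈ T', w ≠ x ∧ deg G T' w ≤ 1 := by
      by_contra! hall
      have h1 := sum_deg_add_two_le ⟨x, hxT'⟩ fun hc => hnc (hc.mono hTT)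
      rw [← Finset.add_sum_erase _ _ hxT'] at h1
      have h2 : (T'.erase x).card • 2 ≤ ∑ v ∈ T'.erase x, deg G T' v :=
        Finset.card_nsmul_le_sum _ _ _ fun v hv =>
          hall v (Finset.mem_erase.1 hv).2 (Finset.mem_erase.1 hv).1
      rw [Finset.card_erase_of_mem hxT', smul_eq_mul] at h2
      have h3 := Finset.card_pos.2 ⟨x, hxT'⟩
      have h4 : deg G T' x = 0 := by omega
      apply hnc
      refine ⟨T'.erase x, (Finset.erase_subset _ _).trans hTT, ?_, ?_⟩
      · rw [Finset.subset_singleton_iff'] at hone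
        push Not at hone
        obtain ⟨w, hw, hwx⟩ := hone
        exact ⟨w, Finset.mem_erase.2 ⟨hwx, hw⟩⟩
      · intro v hv
        obtain ⟨hvx, hv⟩ := Finset.mem_erase.1 hv
        rw [deg_erase_of_not_adj]
        · exact hall v hv hvx
        · intro hvx
          have := deg_pos hv hvx.symm
          omega
    obtain ⟨w, hwT', hwx, hdw⟩ := hw
    have hwT := hTT hwT'
    have hdT : 2 ≤ deg G T w := by
      simp only [hT', Finset.mem_filter] at hwT'
      tauto
    have hsplit : deg G T w = deg G T' w + deg G (T \ T') w := by
      rw [← deg_union Finset.disjoint_sdiff, Finset.union_sdiff_of_subset hTT]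
    obtain ⟨u, hu, hwu⟩ := exists_adj (G := G) (S := T \ T') (v := w) (by omega)
    obtain ⟨huT, huT'⟩ := Finset.mem_sdiff.1 hu
    obtain ⟨hux, hdu⟩ := hleaf u huT huT'
    have hwAB := h.leaf_nbr huT hux hdu hwu.symm
    have h3 := h.crit.three_le w (h.sub hwT) hwx
    have h4 : deg G (S \ T) w = 0 := by
      by_contra h0
      obtain ⟨y, hy, hwy⟩ := exists_adj (Nat.pos_of_ne_zero h0)
      exact hwAB (h.mem_union hwT hy hwy)
    rw [h.deg_eq] at h3
    obtain ⟨u', hu', hwu', hne⟩ := exists_adj_notMem (G := G) (S := T \ T') (F := {u}) (v := w)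
      (by simp; omega)
    obtain ⟨huT2, huT2'⟩ := Finset.mem_sdiff.1 hu'
    obtain ⟨hux', hdu'⟩ := hleaf u' huT2 huT2'
    have huu : u ≠ u' := by rintro rfl; simp at hne
    rcases h.leaf huT hux hdu with ⟨a1, a2, a3⟩ | ⟨a1, a2, a3⟩ <;>
      rcases h.leaf huT2 hux' hdu' with ⟨b1, b2, b3⟩ | ⟨b1, b2, b3⟩
    · exact h.not_two_leaves huT huT2 hwT huu hwu.symm hwu'.symm a2 b3
    · exact hdiff u huT u' huT2 huT' huT2' a1 b1
    · exact hdiff u' huT2 u huT huT2' huT' b1 a1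
    · exact h.symm.not_two_leaves huT huT2 hwT huu hwu.symm hwu'.symm a2 b3

end Frame

theorem Crit.false {S : Finset V} {x : V} (h : Crit G S x) : False := by
  obtain ⟨T, A, B, c, hf⟩ := h.exists_frame
  exact hf.false

theorem exists_ne_of_three_le_deg {S : Finset V} {v : V} (h : 3 ≤ deg G S v) (a b : V) :
    ∃ w ∈ S, w ≠ a ∧ w ≠ b ∧ G.Adj v w := by
  obtain ⟨w, h1, h2, h3⟩ := exists_adj_notMem (F := {a, b})
    ((Finset.card_le_two (a := a) (b := b)).trans_lt (show 2 < deg G S v by omega))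
  simp only [Finset.mem_insert, Finset.mem_singleton, not_or] at h3
  exact ⟨w, h1, h3.1, h3.2, h2⟩

/-- A set in which all degrees but one are at least three contains a cycle of length divisible
by three. -/
theorem hasCycle_of_three_le_deg {S : Finset V} {x : V} (h : ∀ v ∈ S, v ≠ x → 3 ≤ deg G S v)
    (hne : ∃ v ∈ S, v ≠ x) : HasCycle G S := by
  induction hn : S.card using Nat.strong_induction_on generalizing S x with
  | _ n ih =>
  by_contra hno
  have IH : ∀ R ⊂ S, ∀ y, (∀ v ∈ R, v ≠ y → 3 ≤ deg G R v) → (∃ v ∈ R, v ≠ y) → False := by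
    intro R hR y h1 h2
    exact hno ((ih _ (hn ▸ Finset.card_lt_card hR) h1 h2 rfl).mono hR.subset)
  clear ih hn
  wlog hx : x ∈ S generalizing x
  · obtain ⟨v, hv, hvx⟩ := hne
    obtain ⟨w, hw, hwv, -⟩ := exists_ne_of_three_le_deg (h v hv hvx) v v
    exact this (x := v) (fun u hu _ => h u hu (by rintro rfl; exact hx hu)) ⟨w, hw, hwv⟩ hv
  by_cases hd : deg G S x ≤ 1
  · obtain ⟨y, hy⟩ : ∃ y, ∀ v ∈ S, v ≠ y → ¬G.Adj v x := by
      by_cases h0 : ∃ y ∈ S, G.Adj x y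
      · obtain ⟨y, hyS, hy⟩ := h0
        refine ⟨y, fun v hv hvy hvx => ?_⟩
        have := two_le_deg hyS hv hvy.symm hy hvx.symm
        omega
      · push Not at h0
        exact ⟨x, fun v hv _ h' => h0 v hv h'.symm⟩
    refine IH _ (Finset.erase_ssubset hx) y ?_ ?_
    · intro v hv hvy
      obtain ⟨h1, h2⟩ := Finset.mem_erase.1 hv
      rw [deg_erase_of_not_adj (hy v h2 hvy)]
      exact h v h2 h1
    · obtain ⟨v, hv, hvx⟩ := hne
      by_cases hvy : v = y
      · obtain ⟨w, hw, h1, h2, -⟩ := exists_ne_of_three_le_deg (h v hv hvx) x y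
        exact ⟨w, Finset.mem_erase.2 ⟨h1, hw⟩, h2⟩
      · exact ⟨v, Finset.mem_erase.2 ⟨hvx, hv⟩, hvy⟩
  refine Crit.false (G := G) (S := S) (x := x) ⟨hx, by omega, h, hno, ?_⟩
  intro R hRS hRne hR2 b₀
  by_contra! hb
  have hss : R ⊂ S := hRS.ssubset_of_ne hRne
  by_cases hxR : x ∈ R ∧ x ≠ b₀
  · obtain ⟨hxR, hxb⟩ := hxR
    obtain ⟨t, htS, htR, htb⟩ : ∃ t ∈ S, t ∉ R ∧ t ≠ b₀ := by
      obtain ⟨t, htS, htR⟩ := Finset.exists_of_ssubset hss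
      by_cases htb : t = b₀
      · obtain ⟨w, hw, hwt, -, htw⟩ :=
          exists_ne_of_three_le_deg (h t htS (by rintro rfl; exact htR hxR)) t t
        refine ⟨w, hw, fun hwR => ?_, htb ▸ hwt⟩
        exact hb w hwR (htb ▸ hwt) t (Finset.mem_sdiff.2 ⟨htS, htR⟩) htw.symm
      · exact ⟨t, htS, htR, htb⟩
    have hdeg : ∀ v ∈ S \ R, deg G S v = deg G ((S \ R) ∪ (R ∩ {b₀})) v := by
      intro v hv
      refine deg_congr fun w hw => ⟨fun hwS => ?_, fun hwS => ?_⟩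
      · by_cases hwR : w ∈ R
        · by_cases hwb : w = b₀
          · grind
          · exact absurd hw.symm (hb w hwR hwb v hv)
        · simp [hwR, hwS]
      · grind
    refine IH ((S \ R) ∪ (R ∩ {b₀})) ?_ b₀ ?_ ⟨t, by simp [htS, htR], htb⟩
    · refine Finset.ssubset_iff_subset_ne.2 ⟨by grind, fun he => ?_⟩
      have : x ∈ (S \ R) ∪ (R ∩ {b₀}) := by rwa [he]
      grind
    · intro v hv hvb
      have hv' : v ∈ S \ R := by grind
      rw [← hdeg v hv']
      exact h v (by grind) (by grind)
  · refine IH R hss b₀ ?_ ?_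
    · intro v hv hvb
      have : deg G S v = deg G R v := deg_congr fun w hw =>
        ⟨fun hwS => by_contra fun hwR => hb v hv hvb w (by simp [*]) hw, fun hw => hRS hw⟩
      rw [← this]
      exact h v (hRS hv) (by grind)
    · obtain ⟨v, hv, hvb⟩ := Finset.exists_mem_ne (by omega : 1 < R.card) b₀
      exact ⟨v, hv, hvb⟩

/-- The graph obtained from `G` by making all neighbours of `q` adjacent to `p`. -/
def merge (G : SimpleGraph V) (p q : V) : SimpleGraph V where
  Adj u v := u ≠ v ∧ (G.Adj u v ∨ (u = p ∧ G.Adj q v) ∨ (v = p ∧ G.Adj q u))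
  symm := ⟨fun u v h => ⟨h.1.symm, by have := h.2; rw [G.adj_comm v u]; tauto⟩⟩
  loopless := ⟨fun u h => h.1 rfl⟩

theorem deg_le_deg_of_le {G' : SimpleGraph V} (h : G ≤ G') (S : Finset V) (v : V) :
    deg G S v ≤ deg G' S v := by
  classical
  exact Finset.card_le_card (Finset.monotone_filter_right _ fun w _ hw => h hw)

theorem le_merge (p q : V) : G ≤ merge G p q := fun _ _ h => ⟨h.ne, .inl h⟩

theorem deg_le_deg_merge {S : Finset V} {p q v : V} (hp : p ∈ S) (hq : q ∉ S) (hv : v ≠ p)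
    (h : G.Adj v p → ¬G.Adj v q) : deg G (insert q S) v ≤ deg (merge G p q) S v := by
  by_cases hvq : G.Adj v q
  · rw [deg_insert_of_adj hq hvq, ← deg_erase_of_not_adj (S := S) fun h' => h h' hvq,
      ← deg_erase_of_adj (G := merge G p q) hp ⟨hv, .inr (.inr ⟨rfl, hvq.symm⟩)⟩]
    exact Nat.succ_le_succ (deg_le_deg_of_le (le_merge p q) _ _)
  · rw [deg_insert_of_not_adj hvq]
    exact deg_le_deg_of_le (le_merge p q) _ _

theorem HasCycle.of_merge {S S' T : Finset V} {p q : V} {n : ℕ} (h : HasCycle (merge G p q) S')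
    (hp : PathOn G T p q n) (hn : 3 ∣ n) (hT : T ⊆ S) (hS' : S' ⊆ S)
    (hd : ∀ z ∈ S', z ∈ T → z = p) : HasCycle G S := by
  obtain ⟨S₀, hS₀, u, v, m, hm, h2, hvu, h3⟩ := h
  have hG : ∀ a b, a ≠ p → b ≠ p → (merge G p q).Adj a b → G.Adj a b := by
    intro a b ha hb hab
    rcases hab.2 with h | ⟨h, -⟩ | ⟨h, -⟩
    exacts [h, absurd h ha, absurd h hb]
  by_cases hpS : p ∈ S₀
  · obtain ⟨c, hc⟩ := hm.exists_isCyc h2 hvu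
    obtain ⟨i, hi⟩ := (hc.mem p).1 hpS
    replace hc := hc.shift i
    have hc0 : (fun j => c (i + j)) 0 = p := hi
    generalize (fun j => c (i + j)) = c at hc hc0
    have hnp : ∀ j, 0 < j → j < m + 1 → c j ≠ p := fun j h1 h2 =>
      hc0 ▸ (hc.apply_ne (i := 0) h1 (by omega)).symm
    have harc := hc.arc 1 (d := m - 1) (by omega)
    set S₁ := (Finset.range (m - 1 + 1)).image fun k => c (1 + k) with hS₁
    have hS₁p : ∀ a ∈ S₁, a ∈ S' ∧ a ≠ p := by
      intro a ha
      obtain ⟨k, hk, rfl⟩ := Finset.mem_image.1 ha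
      exact ⟨hS₀ (hc.apply_mem _), hnp _ (by omega) (by have := Finset.mem_range.1 hk; omega)⟩
    have harc' := harc.mono fun a ha b hb => hG a b (hS₁p a ha).2 (hS₁p b hb).2
    have hdT : Disjoint T S₁ := Finset.disjoint_left.2 fun z h1 h2 =>
      (hS₁p z h2).2 (hd z (hS₁p z h2).1 h1)
    have hS₁S : S₁ ⊆ S := fun z hz => hS' (hS₁p z hz).1
    have hend : ∀ a ∈ S₁, (merge G p q).Adj p a → G.Adj p a ∨ G.Adj q a := by
      rintro a ha ⟨-, h | ⟨-, h⟩ | ⟨h, -⟩⟩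
      exacts [.inl h, .inr h, absurd h (hS₁p a ha).2]
    have e1 := hend _ harc'.left_mem (hc0 ▸ hc.adj 0)
    have e2 := hend _ harc'.right_mem (by
      have h1 := hc.adj' (1 + (m - 1))
      have h2 := hc.apply_add_self 0
      rwa [show 1 + (m - 1) + 1 = 0 + (m + 1) by omega, h2, hc0] at h1)
    have hpT := hp.left_mem
    have hqT := hp.right_mem
    have hsing : ∀ r ∈ T, G.Adj r (c 1) → G.Adj r (c (1 + (m - 1))) → HasCycle G S := by
      intro r hr h1 h2
      refine .of_ring (.nil r) harc' (by simpa using hT hr) hS₁S ?_ h1 h2 (by omega) (by omega)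
      simpa using Finset.disjoint_left.1 hdT hr
    rcases e1 with e1 | e1 <;> rcases e2 with e2 | e2
    · exact hsing p hpT e1 e2
    · exact .of_ring hp harc' hT hS₁S hdT e1 e2 (by omega) (by omega)
    · exact .of_ring hp.symm harc' hT hS₁S hdT e1 e2 (by omega) (by omega)
    · exact hsing q hqT e1 e2
  · exact ⟨S₀, hS₀.trans hS', u, v, m, hm.mono fun a ha b hb => hG a b (by grind) (by grind), h2,
      hG v u (by grind [hm.right_mem]) (by grind [hm.left_mem]) hvu, h3⟩

theorem PathOn.three {a x y b : V} (h1 : G.Adj a x) (h2 : G.Adj x y) (h3 : G.Adj y b)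
    (h4 : a ≠ y) (h5 : a ≠ b) (h6 : x ≠ b) : PathOn G {a, x, y, b} a b 3 :=
  .cons h1 (by simp [h1.ne, h4, h5]) (.cons h2 (by simp [h2.ne, h6]) (.of_adj h3))

theorem HasCycle.of_triangle {S : Finset V} {a b c : V} (ha : a ∈ S) (hb : b ∈ S) (hc : c ∈ S)
    (h1 : G.Adj a b) (h2 : G.Adj b c) (h3 : G.Adj c a) : HasCycle G S :=
  ⟨{a, b, c}, by grind, a, c, 2, .cons h1 (by simp [h1.ne, h3.ne']) (.of_adj h2), le_rfl, h3,
    by norm_num⟩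

theorem eq_or_eq_of_deg_le_two {S : Finset V} {v a b w : V} (h : deg G S v ≤ 2) (ha : a ∈ S)
    (hb : b ∈ S) (hab : a ≠ b) (h1 : G.Adj v a) (h2 : G.Adj v b) (hw : w ∈ S) (hvw : G.Adj w v) :
    w = a ∨ w = b := by
  by_contra! hne
  have := card_le_deg (G := G) (S := S) (F := {a, b, w}) (v := v) (by
    simp only [Finset.mem_insert, Finset.mem_singleton]
    rintro u (rfl | rfl | rfl)
    exacts [⟨ha, h1⟩, ⟨hb, h2⟩, ⟨hw, hvw.symm⟩])
  rw [Finset.card_eq_three.2 ⟨a, b, w, hab, hne.1.symm, hne.2.symm, rfl⟩] at this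
  omega

theorem eq_of_deg_le_three {S : Finset V} {v a b c w : V} (h : deg G S v ≤ 3) (ha : a ∈ S)
    (hb : b ∈ S) (hc : c ∈ S) (hab : a ≠ b) (hac : a ≠ c) (hbc : b ≠ c) (h1 : G.Adj v a)
    (h2 : G.Adj v b) (h3 : G.Adj v c) (hw : w ∈ S) (hvw : G.Adj w v) :
    w = a ∨ w = b ∨ w = c := by
  by_contra! hne
  have h4 := deg_erase_of_adj hw hvw.symm
  rcases eq_or_eq_of_deg_le_two (G := G) (S := S.erase w) (v := v) (w := c) (by omega)
    (Finset.mem_erase.2 ⟨hne.1.symm, ha⟩) (Finset.mem_erase.2 ⟨hne.2.1.symm, hb⟩) hab h1 h2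
    (Finset.mem_erase.2 ⟨hne.2.2.symm, hc⟩) h3.symm with h | h
  exacts [hac h.symm, hbc h.symm]

theorem deg_sdiff_eq {S U : Finset V} {v : V} (h : ∀ w ∈ U, ¬G.Adj v w) :
    deg G (S \ U) v = deg G S v :=
  deg_congr fun w hw => by
    simp only [Finset.mem_sdiff, and_iff_left_iff_imp]
    exact fun _ hwU => h w hwU hw

theorem le_deg_sdiff_add_one {S U : Finset V} {v x : V} (h : ∀ w ∈ U, w ≠ x → ¬G.Adj v w) :
    deg G S v ≤ deg G (S \ U) v + 1 := by
  refine (le_deg_erase_add_one S x v).trans (Nat.succ_le_succ ?_)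
  rw [← deg_sdiff_eq (S := S.erase x) (U := U.erase x) (by grind)]
  exact deg_mono (by grind) v

set_option maxHeartbeats 1000000 in
/-- If all degrees in `S` but those of two adjacent vertices are at least three, then `S` contains
a cycle of length divisible by three. -/
theorem hasCycle_of_three_le_deg_of_adj {S : Finset V} {x y : V} (hxy : x = y ∨ G.Adj x y)
    (h : ∀ v ∈ S, v ≠ x → v ≠ y → 3 ≤ deg G S v) (hne : ∃ v ∈ S, v ≠ x ∧ v ≠ y) :
    HasCycle G S := by
  induction hn : S.card using Nat.strong_induction_on generalizing S x y G with
  | _ n ih =>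
  by_contra hno
  have IH : ∀ (G' : SimpleGraph V) (R : Finset V), R ⊂ S → ∀ u v, (u = v ∨ G'.Adj u v) →
      (∀ w ∈ R, w ≠ u → w ≠ v → 3 ≤ deg G' R w) → (∃ w ∈ R, w ≠ u ∧ w ≠ v) → HasCycle G' R :=
    fun G' R hR u v huv h1 h2 => ih _ (hn ▸ Finset.card_lt_card hR) huv h1 h2 rfl
  clear ih hn
  have hno' : ∀ R ⊆ S, ∀ u, (∀ v ∈ R, v ≠ u → 3 ≤ deg G R v) → ¬∃ v ∈ R, v ≠ u :=
    fun R hR u h1 h2 => hno ((hasCycle_of_three_le_deg h1 h2).mono hR)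
  obtain ⟨v₀, hv₀, hvx, hvy⟩ := hne
  have hxS : x ∈ S := by
    by_contra hx
    exact hno' S subset_rfl y (fun v hv hvy => h v hv (by grind) hvy) ⟨v₀, hv₀, hvy⟩
  have hyS : y ∈ S := by
    by_contra hy
    exact hno' S subset_rfl x (fun v hv hvx => h v hv hvx (by grind)) ⟨v₀, hv₀, hvx⟩
  rcases hxy with rfl | hxy
  · exact hno' S subset_rfl x (fun v hv hvx => h v hv hvx hvx) ⟨v₀, hv₀, hvx⟩
  have htri : ∀ a ∈ S, ∀ b ∈ S, ∀ c ∈ S, G.Adj a b → G.Adj b c → ¬G.Adj c a :=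
    fun a ha b hb c hc h1 h2 h3 => hno (.of_triangle ha hb hc h1 h2 h3)
  have hdx : deg G S x = 2 := by
    by_contra hd
    rcases le_or_gt (deg G S x) 1 with h1 | h1
    · refine hno' (S.erase x) (Finset.erase_subset _ _) y (fun v hv hvy => ?_)
        ⟨v₀, by simp [*], hvy⟩
      obtain ⟨hvx, hv⟩ := Finset.mem_erase.1 hv
      rw [deg_erase_of_not_adj]
      · exact h v hv hvx hvy
      · intro h'
        have := two_le_deg hyS hv hvy.symm hxy h'.symm
        omega
    · exact hno' S subset_rfl y (fun v hv hvy => by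
        by_cases hvx : v = x
        · subst hvx; omega
        · exact h v hv hvx hvy) ⟨v₀, hv₀, hvy⟩
  have hdy : deg G S y = 2 := by
    by_contra hd
    rcases le_or_gt (deg G S y) 1 with h1 | h1
    · refine hno' (S.erase y) (Finset.erase_subset _ _) x (fun v hv hvx => ?_)
        ⟨v₀, by simp [*], hvx⟩
      obtain ⟨hvy, hv⟩ := Finset.mem_erase.1 hv
      rw [deg_erase_of_not_adj]
      · exact h v hv hvx hvy
      · intro h'
        have := two_le_deg hxS hv hvx.symm hxy.symm h'.symm
        omega
    · exact hno' S subset_rfl x (fun v hv hvx => by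
        by_cases hvy : v = y
        · subst hvy; omega
        · exact h v hv hvx hvy) ⟨v₀, hv₀, hvx⟩
  obtain ⟨a, haS, hxa, hay⟩ := exists_adj_notMem (G := G) (S := S) (F := {y}) (v := x)
    (by rw [hdx]; simp)
  obtain ⟨b, hbS, hyb, hbx⟩ := exists_adj_notMem (G := G) (S := S) (F := {x}) (v := y)
    (by rw [hdy]; simp)
  rw [Finset.mem_singleton] at hay hbx
  have hNx : ∀ w ∈ S, G.Adj w x → w = y ∨ w = a := fun w hw =>
    eq_or_eq_of_deg_le_two hdx.le hyS haS (Ne.symm hay) hxy hxa hw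
  have hNy : ∀ w ∈ S, G.Adj w y → w = x ∨ w = b := fun w hw =>
    eq_or_eq_of_deg_le_two hdy.le hxS hbS (Ne.symm hbx) hxy.symm hyb hw
  have hab : a ≠ b := by
    rintro rfl
    exact htri x hxS y hyS a haS hxy hyb hxa.symm
  have hax : a ≠ x := hxa.ne'
  have hby : b ≠ y := hyb.ne'
  have hxy' : x ≠ y := hxy.ne
  have sy : ∀ u v, G.Adj u v ↔ G.Adj v u := G.adj_comm
  have irr : ∀ u, ¬G.Adj u u := fun u => G.irrefl
  by_cases hZ : ∃ z, (a = z ∨ G.Adj a z) ∧ ∀ w ∈ S, G.Adj w a → G.Adj w b → w = z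
  · obtain ⟨z, haz, hz⟩ := hZ
    refine hno (.of_merge (p := a) (q := b) (n := 3) (S' := S \ {x, y, b}) ?_
      (.three hxa.symm hxy hyb hay hab (Ne.symm hbx)) dvd_rfl (by simp [Finset.insert_subset_iff, *])
      Finset.sdiff_subset (by clear h IH hno' htri; grind))
    refine IH _ _ ?_ a z (haz.imp_right fun h => le_merge _ _ h) ?_ ?_
    · exact Finset.ssubset_iff_subset_ne.2 ⟨by grind, fun he => by grind⟩
    · intro v hv hva hvz
      simp only [Finset.mem_sdiff, Finset.mem_insert, Finset.mem_singleton, not_or] at hv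
      obtain ⟨hv, hvx, hvy, hvb⟩ := hv
      refine le_trans ?_ (deg_le_deg_merge (by grind) (by grind) hva
        fun h1 h2 => hvz (hz v hv h1 h2))
      rw [← deg_congr (S := S)]
      · exact h v hv hvx hvy
      · intro w hw
        clear h IH hno' htri
        simp only [Finset.mem_insert, Finset.mem_sdiff, Finset.mem_singleton]
        have h1 : w ≠ x := by grind
        have h2 : w ≠ y := by grind
        rcases eq_or_ne w b with rfl | h3
        · simp [hbS]
        · simp [h1, h2, h3]
    · obtain ⟨w, hw, hwx, hwb, haw⟩ := exists_ne_of_three_le_deg (h a haS hax hay) x b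
      by_cases hwz : w = z
      · obtain ⟨w', hw', hwa', hwb', hww'⟩ :=
          exists_ne_of_three_le_deg (h w hw hwx (by grind)) a b
        exact ⟨w', by grind, hwa', by grind⟩
      · exact ⟨w, by grind, by grind, hwz⟩
  clear hvx hvy hv₀ v₀
  push Not at hZ
  obtain ⟨z₁, hz₁, hz₁a, hz₁b, -⟩ := hZ a (.inl rfl)
  obtain ⟨z₂, hz₂, hz₂a, hz₂b, hz⟩ := hZ z₁ (.inr hz₁a.symm)
  have hnab : ¬G.Adj a b := fun h' => htri _ haS _ hbS _ hz₁ h' hz₁b.symm hz₁a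
  have hz₁x : z₁ ≠ x := by grind
  have hz₁y : z₁ ≠ y := by grind
  have hz₂x : z₂ ≠ x := by grind
  have hz₂y : z₂ ≠ y := by grind
  have hnz : ¬G.Adj z₁ z₂ := fun h' => htri _ hz₁ _ hz₂ _ haS h' hz₂a hz₁a.symm
  have hda : deg G S a ≤ 3 := by
    by_contra hd
    refine hno' (S \ {x, y}) (by grind) b (fun v hv hvb => ?_) ⟨a, by grind, hab⟩
    by_cases hva : v = a
    · subst hva
      have := le_deg_sdiff_add_one (G := G) (S := S) (U := {x, y}) (v := v) (x := x)
        (by clear h IH hno' htri; grind)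
      omega
    · rw [deg_sdiff_eq]
      · exact h v (by grind) (by grind) (by grind)
      · clear h IH hno' htri
        simp only [Finset.mem_insert, Finset.mem_singleton]
        grind
  have hdb : deg G S b ≤ 3 := by
    by_contra hd
    refine hno' (S \ {x, y}) (by grind) a (fun v hv hva => ?_) ⟨b, by grind, hab.symm⟩
    by_cases hvb : v = b
    · subst hvb
      have := le_deg_sdiff_add_one (G := G) (S := S) (U := {x, y}) (v := v) (x := y)
        (by clear h IH hno' htri; grind)
      omega
    · rw [deg_sdiff_eq]
      · exact h v (by grind) (by grind) (by grind)
      · clear h IH hno' htri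
        simp only [Finset.mem_insert, Finset.mem_singleton]
        grind
  have hNa : ∀ w ∈ S, G.Adj w a → w = x ∨ w = z₁ ∨ w = z₂ := fun w hw =>
    eq_of_deg_le_three hda hxS hz₁ hz₂ hz₁x.symm hz₂x.symm hz.symm hxa.symm hz₁a.symm hz₂a.symm hw
  have hNb : ∀ w ∈ S, G.Adj w b → w = y ∨ w = z₁ ∨ w = z₂ := fun w hw =>
    eq_of_deg_le_three hdb hyS hz₁ hz₂ hz₁y.symm hz₂y.symm hz.symm hyb.symm hz₁b.symm hz₂b.symm hw
  have key : ∀ z z', z ∈ S → z' ∈ S → z ≠ z' → G.Adj z a → G.Adj z b → G.Adj z' a → G.Adj z' b →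
      z ≠ x → z ≠ y → (∀ w ∈ S, G.Adj w a → w = x ∨ w = z ∨ w = z') →
      (∀ w ∈ S, G.Adj w b → w = y ∨ w = z ∨ w = z') → deg G S z ≤ 3 := by
    intro z z' hzS hz'S hzz hza hzb hza' hzb' hzx hzy hNa hNb
    by_contra hd
    refine hno ((IH G (S \ {x, y, b}) ?_ a z' (.inr hza'.symm) ?_ ⟨z, by grind, by grind,
      hzz⟩).mono Finset.sdiff_subset)
    · exact Finset.ssubset_iff_subset_ne.2 ⟨by grind, fun he => by grind⟩
    · intro v hv hva hvz
      by_cases hvz' : v = z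
      · subst hvz'
        have := le_deg_sdiff_add_one (G := G) (S := S) (U := {x, y, b}) (v := v) (x := b)
          (by clear h IH hno' htri; grind)
        omega
      · rw [deg_sdiff_eq]
        · exact h v (by grind) (by grind) (by grind)
        · clear h IH hno' htri
          simp only [Finset.mem_insert, Finset.mem_singleton]
          grind
  have hd₁ := key z₁ z₂ hz₁ hz₂ hz.symm hz₁a hz₁b hz₂a hz₂b hz₁x hz₁y hNa hNb
  have hd₂ := key z₂ z₁ hz₂ hz₁ hz hz₂a hz₂b hz₁a hz₁b hz₂x hz₂y (by grind) (by grind)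
  clear key
  obtain ⟨u₁, hu₁, hu₁a, hu₁b, hzu₁⟩ := exists_ne_of_three_le_deg (h z₁ hz₁ hz₁x hz₁y) a b
  obtain ⟨u₂, hu₂, hu₂a, hu₂b, hzu₂⟩ := exists_ne_of_three_le_deg (h z₂ hz₂ hz₂x hz₂y) a b
  have hN₁ : ∀ w ∈ S, G.Adj w z₁ → w = a ∨ w = b ∨ w = u₁ := fun w hw =>
    eq_of_deg_le_three hd₁ haS hbS hu₁ hab hu₁a.symm hu₁b.symm hz₁a hz₁b hzu₁ hw
  have hN₂ : ∀ w ∈ S, G.Adj w z₂ → w = a ∨ w = b ∨ w = u₂ := fun w hw =>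
    eq_of_deg_le_three hd₂ haS hbS hu₂ hab hu₂a.symm hu₂b.symm hz₂a hz₂b hzu₂ hw
  have hu₁x : u₁ ≠ x := by grind
  have hu₁y : u₁ ≠ y := by grind
  have hu₂x : u₂ ≠ x := by grind
  have hu₂y : u₂ ≠ y := by grind
  have hu₁z₂ : u₁ ≠ z₂ := fun h' => hnz (h' ▸ hzu₁)
  have hu₂z₁ : u₂ ≠ z₁ := fun h' => hnz (h' ▸ hzu₂.symm)
  have hout : ∀ v ∈ S, v ∉ ({x, y, a, b, z₁, z₂} : Finset V) →
      ∀ w ∈ ({x, y, a, b, z₁, z₂} : Finset V), G.Adj v w →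
        (w = z₁ ∧ v = u₁) ∨ (w = z₂ ∧ v = u₂) := by
    intro v hv hvU w hw hvw
    simp only [Finset.mem_insert, Finset.mem_singleton, not_or] at hvU hw
    obtain ⟨h1, h2, h3, h4, h5, h6⟩ := hvU
    rcases hw with rfl | rfl | rfl | rfl | rfl | rfl
    · exact absurd (hNx v hv hvw) (by simp [*])
    · exact absurd (hNy v hv hvw) (by simp [*])
    · exact absurd (hNa v hv hvw) (by simp [*])
    · exact absurd (hNb v hv hvw) (by simp [*])
    · exact .inl ⟨rfl, by simpa [*] using hN₁ v hv hvw⟩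
    · exact .inr ⟨rfl, by simpa [*] using hN₂ v hv hvw⟩
  have hUS : ({x, y, a, b, z₁, z₂} : Finset V) ⊆ S := by simp [Finset.insert_subset_iff, *]
  have hu₁U : u₁ ∉ ({x, y, a, b, z₁, z₂} : Finset V) := by simp [*, hzu₁.ne']
  have hu₂U : u₂ ∉ ({x, y, a, b, z₁, z₂} : Finset V) := by simp [*, hzu₂.ne']
  have hp : PathOn G {u₁, z₁, a, z₂} u₁ z₂ 3 :=
    .three hzu₁.symm hz₁a hz₂a.symm hu₁a hu₁z₂ hz.symm
  have hpU : ({u₁, z₁, a, z₂} : Finset V) ⊆ insert u₁ {x, y, a, b, z₁, z₂} := by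
    clear h IH hno' htri hNx hNy hNa hNb hN₁ hN₂
    grind
  have hxU : x ∈ ({x, y, a, b, z₁, z₂} : Finset V) := by simp
  have hyU : y ∈ ({x, y, a, b, z₁, z₂} : Finset V) := by simp
  generalize ({x, y, a, b, z₁, z₂} : Finset V) = U at hout hUS hu₁U hu₂U hpU hxU hyU
  have hdeg : ∀ v ∈ S \ U, v ≠ u₁ → v ≠ u₂ → 3 ≤ deg G (S \ U) v := by
    intro v hv hv₁ hv₂
    obtain ⟨hv, hvU⟩ := Finset.mem_sdiff.1 hv
    rw [deg_sdiff_eq]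
    · exact h v hv (by rintro rfl; exact hvU hxU) (by rintro rfl; exact hvU hyU)
    · intro w hw hvw
      rcases hout v hv hvU w hw hvw with h' | h'
      exacts [hv₁ h'.2, hv₂ h'.2]
  by_cases hu : u₁ = u₂
  · refine hno' (S \ U) Finset.sdiff_subset u₁ (fun v hv hv₁ => hdeg v hv hv₁ (hu ▸ hv₁)) ?_
    obtain ⟨w, hw, h1, h2, h3⟩ := exists_ne_of_three_le_deg (h u₁ hu₁ hu₁x hu₁y) z₁ z₂
    refine ⟨w, Finset.mem_sdiff.2 ⟨hw, fun hwU => ?_⟩, h3.ne'⟩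
    rcases hout u₁ hu₁ hu₁U w hwU h3 with h' | h'
    exacts [h1 h'.1, h2 h'.1]
  · refine hno (.of_merge (S' := S \ U) ?_ hp dvd_rfl ?_ Finset.sdiff_subset ?_)
    · refine IH _ _ ?_ u₁ u₂ (.inr ⟨hu, .inr (.inl ⟨rfl, hzu₂⟩)⟩) (fun v hv h1 h2 =>
        (hdeg v hv h1 h2).trans (deg_le_deg_of_le (le_merge _ _) _ _)) ?_
      · exact Finset.sdiff_ssubset hUS ⟨x, hxU⟩
      · obtain ⟨w, hw, h1, h2, h3⟩ := exists_ne_of_three_le_deg (h u₁ hu₁ hu₁x hu₁y) z₁ u₂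
        refine ⟨w, Finset.mem_sdiff.2 ⟨hw, fun hwU => ?_⟩, h3.ne', h2⟩
        rcases hout u₁ hu₁ hu₁U w hwU h3 with h' | h'
        exacts [h1 h'.1, hu h'.2]
    · exact hpU.trans (Finset.insert_subset hu₁ hUS)
    · intro z hz hzT
      exact (Finset.mem_insert.1 (hpU hzT)).resolve_right (Finset.mem_sdiff.1 hz).2

/-- `X` has a subset not contained in `E` in which all vertices outside `E` have degree at
least `s`. -/
def Good (G : SimpleGraph V) (E : Finset V) (s : ℕ) (X : Finset V) : Prop :=
  ∃ A ⊆ X, ¬A ⊆ E ∧ ∀ v ∈ A, v ∉ E → s ≤ deg G A v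

theorem Good.mono {E X Y : Finset V} {s : ℕ} (h : Good G E s X) (hXY : X ⊆ Y) : Good G E s Y := by
  obtain ⟨A, hA, h⟩ := h
  exact ⟨A, hA.trans hXY, h⟩

theorem exists_deg_lt_of_not_good {E X : Finset V} {s : ℕ} (h : ¬Good G E s X) (hX : ¬X ⊆ E) :
    ∃ x ∈ X, x ∉ E ∧ deg G X x < s := by
  by_contra! h'
  exact h ⟨X, subset_rfl, hX, h'⟩

/-- A vertex of small degree is not needed. -/
theorem Good.erase {E X : Finset V} {s : ℕ} {x : V} (h : Good G E s X) (hx : x ∉ E)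
    (hd : deg G X x < s) : Good G E s (X.erase x) := by
  obtain ⟨A, hA, h1, h2⟩ := h
  refine ⟨A, fun z hz => Finset.mem_erase.2 ⟨?_, hA hz⟩, h1, h2⟩
  rintro rfl
  have := h2 z hz hx
  have := deg_mono (G := G) hA z
  omega

/-- The weight of a vertex outside the exceptional set `E`. -/
def wt (E : Finset V) (r : ℕ) (v : V) : ℕ := if v ∈ E then 0 else r

theorem wt_of_notMem {E : Finset V} {v : V} (h : v ∉ E) (r : ℕ) : wt E r v = r := if_neg h

theorem wt_le_deg {E X : Finset V} {s : ℕ} {v : V} (h : ¬Good G E s X)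
    (h' : Good G E s (insert v X)) : wt E s v ≤ deg G X v := by
  unfold wt
  split_ifs with hv
  · exact Nat.zero_le _
  · by_contra! hd
    rw [← deg_insert_self] at hd
    exact h ((h'.erase hv hd).mono (by grind))

/-- Twice the weighted number of edges in `X`. -/
noncomputable def weight (G : SimpleGraph V) (E : Finset V) (r : ℕ) (X : Finset V) : ℕ :=
  ∑ v ∈ X, deg G X v + 2 * ∑ v ∈ X, wt E r v

theorem weight_insert {E X : Finset V} {r : ℕ} {v : V} (hv : v ∉ X) :
    weight G E r (insert v X) = weight G E r X + 2 * (deg G X v + wt E r v) := by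
  unfold weight
  rw [sum_deg_insert hv, Finset.sum_insert hv]
  ring

theorem weight_erase {E X : Finset V} {r : ℕ} {v : V} (hv : v ∈ X) :
    weight G E r X = weight G E r (X.erase v) + 2 * (deg G X v + wt E r v) := by
  have := weight_insert (G := G) (E := E) (r := r) (Finset.notMem_erase v X)
  rwa [Finset.insert_erase hv, deg_erase_self] at this

theorem weight_mono {E X Y : Finset V} {r : ℕ} (h : X ⊆ Y) :
    weight G E r X ≤ weight G E r Y := by
  unfold weight
  gcongr ?_ + 2 * ?_
  · exact (Finset.sum_le_sum fun v _ => deg_mono h v).trans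
      (Finset.sum_le_sum_of_subset h)
  · exact Finset.sum_le_sum_of_subset h

/-- A set `S` without triangles that does not split into two sets of minimum degree `s` and `t`,
up to the exceptional vertices in `E`. -/
structure Unsplit (G : SimpleGraph V) (S E : Finset V) (s t : ℕ) : Prop where
  left : 2 ≤ s
  right : 2 ≤ t
  tri : ∀ a ∈ S, ∀ b ∈ S, ∀ c ∈ S, G.Adj a b → G.Adj b c → ¬G.Adj c a
  clique : ∀ a ∈ E, ∀ b ∈ E, a ≠ b → G.Adj a b
  le_deg : ∀ v ∈ S, v ∉ E → s + t ≤ deg G S v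
  notSub : ¬S ⊆ E
  noPair : ∀ A ⊆ S, ∀ B ⊆ S, Disjoint A B → Good G E s A → ¬Good G E t B

namespace Unsplit

variable {S E : Finset V} {s t : ℕ}

theorem symm (h : Unsplit G S E s t) : Unsplit G S E t s :=
  ⟨h.right, h.left, h.tri, h.clique, fun v hv hvE => add_comm s t ▸ h.le_deg v hv hvE, h.notSub,
    fun A hA B hB hAB h1 h2 => h.noPair B hB A hA hAB.symm h2 h1⟩

theorem not_subset (h : Unsplit G S E s t) {X : Finset V} (hX : X ⊆ S) {v : V} (hv : v ∈ S)
    (hd : 2 ≤ deg G X v) : ¬X ⊆ E := by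
  intro hXE
  obtain ⟨a, ha, hva, -⟩ := exists_adj_notMem (G := G) (S := X) (F := ∅) (v := v) (by simp; omega)
  obtain ⟨b, hb, hvb, hab⟩ := exists_adj_notMem (G := G) (S := X) (F := {a}) (v := v)
    (by simp; omega)
  rw [Finset.mem_singleton] at hab
  exact h.tri v hv a (hX ha) b (hX hb) hva (h.clique a (hXE ha) b (hXE hb) (Ne.symm hab)) hvb.symm

/-- A partition of `S` into two bad sets. -/
structure Part (G : SimpleGraph V) (S E : Finset V) (s t : ℕ) (X Y : Finset V) : Prop where
  disj : Disjoint X Y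
  union : X ∪ Y = S
  left : ¬Good G E s X
  right : ¬Good G E t Y

/-- A partition of `S` into a vertex and two bad sets that become good by adding it. -/
structure Trip (G : SimpleGraph V) (S E : Finset V) (s t : ℕ) (X Y : Finset V) (v : V) : Prop where
  notMem : v ∉ X
  notMem' : v ∉ Y
  disj : Disjoint X Y
  union : insert v (X ∪ Y) = S
  left : ¬Good G E s X
  right : ¬Good G E t Y
  left' : Good G E s (insert v X)
  right' : Good G E t (insert v Y)

theorem Part.symm {X Y : Finset V} (h : Part G S E s t X Y) : Part G S E t s Y X :=
  ⟨h.disj.symm, Finset.union_comm X Y ▸ h.union, h.right, h.left⟩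

theorem Trip.symm {X Y : Finset V} {v : V} (h : Trip G S E s t X Y v) : Trip G S E t s Y X v :=
  ⟨h.notMem', h.notMem, h.disj.symm, Finset.union_comm X Y ▸ h.union, h.right, h.left, h.right',
    h.left'⟩

theorem Part.le_deg {X Y : Finset V} (hp : Part G S E s t X Y) (h : Unsplit G S E s t) {v : V}
    (hv : v ∈ S) (hvE : v ∉ E) : s + t ≤ deg G X v + deg G Y v := by
  rw [← deg_union hp.disj, hp.union]
  exact h.le_deg v hv hvE

theorem Part.not_subset {X Y : Finset V} (hp : Part G S E s t X Y) (h : Unsplit G S E s t)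
    (hY : ¬Y ⊆ E) : ¬X ⊆ E := by
  obtain ⟨y, hyY, hyE, hy⟩ := exists_deg_lt_of_not_good hp.right hY
  have hyS : y ∈ S := hp.union ▸ Finset.mem_union_right _ hyY
  have := hp.le_deg h hyS hyE
  have := h.left
  exact h.not_subset (hp.union ▸ Finset.subset_union_left) hyS (by omega)

theorem Part.good_insert {X Y : Finset V} {M : ℕ} (hp : Part G S E s t X Y)
    (h : Unsplit G S E s t)
    (hP : ∀ X Y, Part G S E s t X Y → weight G E t X + weight G E s Y ≤ M)
    (hM : M ≤ weight G E t X + weight G E s Y) {x : V} (hx : x ∈ X) (hxE : x ∉ E)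
    (hd : deg G X x < s) : Good G E t (insert x Y) := by
  by_contra hb
  have hxY : x ∉ Y := Finset.disjoint_left.1 hp.disj hx
  have hX := hp.disj
  have hU := hp.union
  have := hP (X.erase x) (insert x Y) ⟨by rw [Finset.disjoint_left] at hX ⊢; grind, by grind,
    fun h' => hp.left (h'.mono (Finset.erase_subset _ _)), hb⟩
  have h1 := weight_erase (G := G) (E := E) (r := t) hx
  have h2 := weight_insert (G := G) (E := E) (r := s) hxY
  rw [wt_of_notMem hxE] at h1 h2
  have := hp.le_deg h (hU ▸ Finset.mem_union_left _ hx) hxE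
  omega

theorem Part.weight_swap {X Y : Finset V} (hp : Part G S E s t X Y) (h : Unsplit G S E s t)
    {x y : V} (hx : x ∈ X) (hxE : x ∉ E) (hdx : deg G X x < s) (hy : y ∈ Y) (hyE : y ∉ E)
    (hdy : deg G Y y < t) (r : ℕ) (hxy : G.Adj x y) :
    weight G E r X + 2 ≤ weight G E r (insert y (X.erase x)) := by
  have hyX : y ∉ X := Finset.disjoint_right.1 hp.disj hy
  have h1 := weight_erase (G := G) (E := E) (r := r) hx
  have h2 := weight_insert (G := G) (E := E) (r := r) (v := y) (X := X.erase x) (by grind)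
  rw [wt_of_notMem hxE] at h1
  rw [wt_of_notMem hyE] at h2
  have h3 := deg_erase_of_adj hx hxy.symm
  have := hp.le_deg h (hp.union ▸ Finset.mem_union_right _ hy) hyE
  omega

/-- A partition of maximum weight cannot be bad. -/
theorem Part.false {X Y : Finset V} {M : ℕ} (hp : Part G S E s t X Y) (h : Unsplit G S E s t)
    (hP : ∀ X Y, Part G S E s t X Y → weight G E t X + weight G E s Y ≤ M)
    (hT : ∀ X Y v, Trip G S E s t X Y v →
      weight G E t X + weight G E s Y + 2 * (wt E s v + wt E t v) ≤ M)
    (hM : M ≤ weight G E t X + weight G E s Y) : False := by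
  have hP' : ∀ X Y, Part G S E t s X Y → weight G E s X + weight G E t Y ≤ M :=
    fun X Y h' => add_comm (weight G E s X) _ ▸ hP _ _ h'.symm
  have hM' : M ≤ weight G E s Y + weight G E t X := add_comm (weight G E t X) _ ▸ hM
  have hD := Finset.disjoint_left.1 hp.disj
  have hU := hp.union
  have hXE : ¬X ⊆ E := fun hX => h.notSub (hU ▸ Finset.union_subset hX
    (by_contra fun hY => hp.not_subset h hY hX))
  obtain ⟨x, hx, hxE, hdx⟩ := exists_deg_lt_of_not_good hp.left hXE
  obtain ⟨y, hy, hyE, hdy⟩ := exists_deg_lt_of_not_good hp.right (hp.symm.not_subset h.symm hXE)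
  have gx := hp.good_insert h hP hM hx hxE hdx
  have gy := hp.symm.good_insert h.symm hP' hM' hy hyE hdy
  have hxY := hD hx
  have hyX : y ∉ X := fun h' => hD h' hy
  have hxyne : x ≠ y := by grind
  have eX : (insert y X).erase x = insert y (X.erase x) := Finset.erase_insert_of_ne hxyne.symm
  have eY : (insert x Y).erase y = insert x (Y.erase y) := Finset.erase_insert_of_ne hxyne
  have hdisj : Disjoint (insert y (X.erase x)) (insert x (Y.erase y)) := by
    rw [Finset.disjoint_left]; clear eX eY hP hP' hT; grind
  have hunion : insert y (X.erase x) ∪ insert x (Y.erase y) = S := by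
    clear eX eY hP hP' hT; grind
  have hno := h.noPair _ (hunion ▸ Finset.subset_union_left) _ (hunion ▸ Finset.subset_union_right)
    hdisj
  by_cases hxy : G.Adj x y
  · have wX := hp.weight_swap h hx hxE hdx hy hyE hdy t hxy
    have wY := hp.symm.weight_swap h.symm hy hyE hdy hx hxE hdx s hxy.symm
    have iX : insert x (insert y (X.erase x)) = insert y X := by
      rw [Finset.insert_comm, Finset.insert_erase hx]
    have iY : insert y (insert x (Y.erase y)) = insert x Y := by
      rw [Finset.insert_comm, Finset.insert_erase hy]
    by_cases h1 : Good G E s (insert y (X.erase x))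
    · have := hT (X.erase x) (insert x (Y.erase y)) y ⟨by grind, by grind,
        hdisj.mono_left (Finset.subset_insert _ _), by rw [← hunion, Finset.insert_union],
        fun h' => hp.left (h'.mono (Finset.erase_subset _ _)), hno h1, h1, iY ▸ gx⟩
      have := weight_erase (G := G) (E := E) (r := t) hx
      simp only [wt_of_notMem hxE, wt_of_notMem hyE] at *
      omega
    · by_cases h2 : Good G E t (insert x (Y.erase y))
      · have := hT (insert y (X.erase x)) (Y.erase y) x ⟨by grind, by grind,
          hdisj.mono_right (Finset.subset_insert _ _), by rw [← hunion, Finset.union_insert],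
          h1, fun h' => hp.right (h'.mono (Finset.erase_subset _ _)), iX ▸ gy, h2⟩
        have := weight_erase (G := G) (E := E) (r := s) hy
        simp only [wt_of_notMem hxE, wt_of_notMem hyE] at *
        omega
      · have := hP _ _ ⟨hdisj, hunion, h1, h2⟩
        omega
  · refine hno (eX ▸ gy.erase hxE ?_) (eY ▸ gx.erase hyE ?_)
    · rwa [deg_insert_of_not_adj hxy]
    · rwa [deg_insert_of_not_adj fun h' => hxy h'.symm]

theorem Trip.le_deg {X Y : Finset V} {v : V} (hp : Trip G S E s t X Y v) (h : Unsplit G S E s t)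
    {u : V} (hu : u ∈ S) (huE : u ∉ E) : s + t ≤ deg G X u + deg G Y u + 1 := by
  have h1 := h.le_deg u hu huE
  have h2 := le_deg_erase_add_one (G := G) S v u
  have h3 : S.erase v = X ∪ Y := by
    rw [← hp.union, Finset.erase_insert (by simp [hp.notMem, hp.notMem'])]
  rw [h3, deg_union hp.disj] at h2
  omega

theorem Trip.adj {X Y : Finset V} {v : V} {M : ℕ} (hp : Trip G S E s t X Y v)
    (h : Unsplit G S E s t)
    (hT : ∀ X Y v, Trip G S E s t X Y v →
      weight G E t X + weight G E s Y + 2 * (wt E s v + wt E t v) ≤ M)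
    (hM : M ≤ weight G E t X + weight G E s Y + 2 * (wt E s v + wt E t v)) {x : V} (hx : x ∈ X)
    (hxE : x ∉ E) (hd : deg G X x < s) :
    ¬Good G E s (insert v (X.erase x)) ∧ G.Adj x v ∧ deg G X x + 1 = s := by
  have hD := Finset.disjoint_left.1 hp.disj
  have hU := hp.union
  have hvX := hp.notMem
  have hvY := hp.notMem'
  have hxY := hD hx
  have hxv : x ≠ v := by grind
  have hb : ¬Good G E s (insert v (X.erase x)) := by
    intro hg
    have hb' : ¬Good G E t (insert x Y) := h.noPair _ (by grind) _ (by grind)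
      (by rw [Finset.disjoint_left]; grind) hg
    have := hT (X.erase x) (insert x Y) v ⟨by grind, by grind,
      by rw [Finset.disjoint_left]; grind, by grind,
      fun h' => hp.left (h'.mono (Finset.erase_subset _ _)), hb', hg,
      hp.right'.mono (Finset.insert_subset_insert _ (Finset.subset_insert _ _))⟩
    have h1 := weight_erase (G := G) (E := E) (r := t) hx
    have h2 := weight_insert (G := G) (E := E) (r := s) hxY
    rw [wt_of_notMem hxE] at h1 h2
    have := hp.le_deg h (u := x) (by grind) hxE
    omega
  have hd' : s ≤ deg G (insert v X) x := by
    by_contra! hlt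
    exact hb (Finset.erase_insert_of_ne hxv.symm ▸ hp.left'.erase hxE hlt)
  have hxv' : G.Adj x v := by
    by_contra hna
    rw [deg_insert_of_not_adj hna] at hd'
    omega
  rw [deg_insert_of_adj hvX hxv'] at hd'
  exact ⟨hb, hxv', by omega⟩

theorem Trip.not_subset {X Y : Finset V} {v : V} (hp : Trip G S E s t X Y v)
    (h : Unsplit G S E s t) : ¬X ⊆ E := by
  have hw := wt_le_deg hp.left hp.left'
  by_cases hv : v ∈ E
  · intro hX
    obtain ⟨A, hA, hAE, -⟩ := hp.left'
    exact hAE (hA.trans (Finset.insert_subset hv hX))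
  · rw [wt_of_notMem hv] at hw
    have hU := hp.union
    exact h.not_subset (by grind) (v := v) (by grind) (h.left.trans hw)

theorem Trip.false {X Y : Finset V} {v : V} {M : ℕ} (hp : Trip G S E s t X Y v)
    (h : Unsplit G S E s t)
    (hP : ∀ X Y, Part G S E s t X Y → weight G E t X + weight G E s Y ≤ M)
    (hT : ∀ X Y v, Trip G S E s t X Y v →
      weight G E t X + weight G E s Y + 2 * (wt E s v + wt E t v) ≤ M)
    (hM : M ≤ weight G E t X + weight G E s Y + 2 * (wt E s v + wt E t v)) : False := by
  have hT' : ∀ X Y v, Trip G S E t s X Y v →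
      weight G E s X + weight G E t Y + 2 * (wt E t v + wt E s v) ≤ M := fun X Y v h' => by
    have := hT _ _ _ h'.symm
    omega
  obtain ⟨x, hx, hxE, hdx⟩ := exists_deg_lt_of_not_good hp.left (hp.not_subset h)
  obtain ⟨y, hy, hyE, hdy⟩ := exists_deg_lt_of_not_good hp.right (hp.symm.not_subset h.symm)
  obtain ⟨hb, hxv, hdx'⟩ := hp.adj h hT hM hx hxE hdx
  obtain ⟨-, hyv, -⟩ := hp.symm.adj h.symm hT' (by omega) hy hyE hdy
  have hD := Finset.disjoint_left.1 hp.disj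
  have hU := hp.union
  have hvX := hp.notMem
  have hvY := hp.notMem'
  have hxY := hD hx
  have hxy : ¬G.Adj y x := fun h' => h.tri y (by grind) x (by grind) v (by grind) h' hxv hyv.symm
  have hdisj : Disjoint (insert v (X.erase x)) Y := by rw [Finset.disjoint_left]; grind
  have hw := wt_le_deg hp.left hp.left'
  have h1 := weight_erase (G := G) (E := E) (r := t) hx
  have h2 := weight_insert (G := G) (E := E) (r := t) (v := v) (X := X.erase x) (by grind)
  have h3 := weight_insert (G := G) (E := E) (r := s) hxY
  have h4 := deg_erase_of_adj hx hxv.symm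
  rw [wt_of_notMem hxE] at h1 h3
  by_cases hg : Good G E t (insert x Y)
  · have hp' : Trip G S E s t (insert v (X.erase x)) Y x := ⟨by grind, hxY, hdisj, by grind, hb,
      hp.right, by rw [Finset.insert_comm, Finset.insert_erase hx]; exact hp.left', hg⟩
    refine hxy (hp'.symm.adj h.symm hT' ?_ hy hyE hdy).2.1
    simp only [wt_of_notMem hxE]
    omega
  · have hp' : Part G S E s t (insert v (X.erase x)) (insert x Y) :=
      ⟨by rw [Finset.disjoint_left]; grind, by grind, hb, hg⟩
    have := hp.le_deg h (u := x) (by grind) hxE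
    exact hp'.false h hP hT (by omega)

theorem false (h : Unsplit G S E s t) : False := by
  classical
  set vals : Set ℕ := {n | (∃ X Y, Part G S E s t X Y ∧ weight G E t X + weight G E s Y = n) ∨
    ∃ X Y v, Trip G S E s t X Y v ∧
      weight G E t X + weight G E s Y + 2 * (wt E s v + wt E t v) = n} with hvals
  have hne : vals.Nonempty := by
    have hex : ∃ n, ∃ A ⊆ S, A.card = n ∧ Good G E s A := ⟨_, S, subset_rfl, rfl, S, subset_rfl,
      h.notSub, fun v hv hvE => (Nat.le_add_right s t).trans (h.le_deg v hv hvE)⟩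
    obtain ⟨A, hA, hAn, hAg⟩ := Nat.find_spec hex
    obtain ⟨v, hv⟩ : A.Nonempty := by
      obtain ⟨B, hB, hBE, -⟩ := hAg
      obtain ⟨b, hb, -⟩ := Finset.not_subset.1 hBE
      exact ⟨b, hB hb⟩
    have hX : ¬Good G E s (A.erase v) := by
      intro h'
      have := Nat.find_min' hex ⟨_, (Finset.erase_subset _ _).trans hA, rfl, h'⟩
      have := Finset.card_erase_lt_of_mem hv
      omega
    have hY := h.noPair A hA (S \ A) Finset.sdiff_subset Finset.disjoint_sdiff hAg
    by_cases hg : Good G E t (insert v (S \ A))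
    · exact ⟨_, .inr ⟨A.erase v, S \ A, v, ⟨by grind, by grind,
        Finset.disjoint_sdiff.mono_left (Finset.erase_subset _ _), by grind, hX, hY,
        (Finset.insert_erase hv).symm ▸ hAg, hg⟩, rfl⟩⟩
    · exact ⟨_, .inl ⟨A.erase v, insert v (S \ A), ⟨by rw [Finset.disjoint_left]; grind,
        by grind, hX, hg⟩, rfl⟩⟩
  have hbdd : BddAbove vals := by
    have hwt : ∀ r v, wt E r v ≤ r := fun r v => by unfold wt; split_ifs <;> omega
    refine ⟨weight G E t S + weight G E s S + 2 * (s + t), ?_⟩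
    rintro n (⟨X, Y, hp, rfl⟩ | ⟨X, Y, v, hp, rfl⟩)
    · have h1 := weight_mono (G := G) (E := E) (r := t) (X := X) (Y := S)
        (hp.union ▸ Finset.subset_union_left)
      have h2 := weight_mono (G := G) (E := E) (r := s) (X := Y) (Y := S)
        (hp.union ▸ Finset.subset_union_right)
      omega
    · have hU := hp.union
      have h1 := weight_mono (G := G) (E := E) (r := t) (X := X) (Y := S) (by grind)
      have h2 := weight_mono (G := G) (E := E) (r := s) (X := Y) (Y := S) (by grind)
      have h3 := hwt s v
      have h4 := hwt t v
      omega
  have hP : ∀ X Y, Part G S E s t X Y → weight G E t X + weight G E s Y ≤ sSup vals :=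
    fun X Y hp => le_csSup hbdd (.inl ⟨X, Y, hp, rfl⟩)
  have hT : ∀ X Y v, Trip G S E s t X Y v →
      weight G E t X + weight G E s Y + 2 * (wt E s v + wt E t v) ≤ sSup vals :=
    fun X Y v hp => le_csSup hbdd (.inr ⟨X, Y, v, hp, rfl⟩)
  rcases Nat.sSup_mem hne hbdd with ⟨X, Y, hp, he⟩ | ⟨X, Y, v, hp, he⟩
  · exact hp.false h hP hT he.ge
  · exact hp.false h hP hT he.ge

end Unsplit

/-- `S` contains `k` disjoint cycles of length divisible by three. -/
def Packs (G : SimpleGraph V) (S : Finset V) (k : ℕ) : Prop :=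
  ∃ f : Fin k → Finset V, (∀ i, f i ⊆ S ∧ HasCycle G (f i)) ∧ ∀ i j, i ≠ j → Disjoint (f i) (f j)

theorem Packs.zero (S : Finset V) : Packs G S 0 :=
  ⟨fun _ => ∅, fun i => i.elim0, fun i => i.elim0⟩

theorem Packs.succ {S A B : Finset V} {k : ℕ} (hA : HasCycle G A) (hB : Packs G B k)
    (hAB : Disjoint A B) (hAS : A ⊆ S) (hBS : B ⊆ S) : Packs G S (k + 1) := by
  obtain ⟨f, hf, hd⟩ := hB
  refine ⟨Fin.cons A f, fun i => ?_, fun i j hij => ?_⟩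
  · cases i using Fin.cases with
    | zero => exact ⟨hAS, hA⟩
    | succ i => exact ⟨(hf i).1.trans hBS, (hf i).2⟩
  · cases i using Fin.cases with
    | zero =>
      cases j using Fin.cases with
      | zero => exact absurd rfl hij
      | succ j => exact hAB.mono_right (hf j).1
    | succ i =>
      cases j using Fin.cases with
      | zero => exact (hAB.mono_right (hf i).1).symm
      | succ j => exact hd i j fun h => hij (congrArg _ h)

/-- A triangle-free set of large minimum degree, up to two adjacent vertices, contains many
disjoint cycles of length divisible by three. -/
theorem packs_of_le_deg {x y : V} (hxy : x = y ∨ G.Adj x y) (k : ℕ) {S : Finset V}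
    (htri : ∀ a ∈ S, ∀ b ∈ S, ∀ c ∈ S, G.Adj a b → G.Adj b c → ¬G.Adj c a)
    (hdeg : ∀ v ∈ S, v ∉ ({x, y} : Finset V) → 3 * (k + 1) ≤ deg G S v)
    (hS : ¬S ⊆ {x, y}) : Packs G S (k + 1) := by
  have base : ∀ A : Finset V, ¬A ⊆ {x, y} →
      (∀ v ∈ A, v ∉ ({x, y} : Finset V) → 3 ≤ deg G A v) → HasCycle G A := by
    intro A hA h
    simp only [Finset.not_subset, Finset.mem_insert, Finset.mem_singleton, not_or] at hA h
    exact hasCycle_of_three_le_deg_of_adj hxy (fun v hv h1 h2 => h v hv ⟨h1, h2⟩) hA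
  induction k generalizing S with
  | zero =>
    exact .succ (base S hS hdeg) (.zero ∅) (Finset.disjoint_empty_right _) subset_rfl
      (Finset.empty_subset _)
  | succ k ih =>
    by_contra hno
    refine Unsplit.false (G := G) (S := S) (E := {x, y}) (s := 3) (t := 3 * (k + 1))
      ⟨by norm_num, by omega, htri, ?_, fun v hv hvE => ?_, hS, ?_⟩
    · intro a ha b hb hab
      simp only [Finset.mem_insert, Finset.mem_singleton] at ha hb
      rcases hxy with rfl | hxy
      · exact absurd ((ha.elim id id).trans (hb.elim id id).symm) hab
      · have := hxy.symm
        rcases ha with rfl | rfl <;> rcases hb with rfl | rfl <;> simp_all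
    · have := hdeg v hv hvE
      omega
    · rintro A hA B hB hAB ⟨A', hA', h1, h2⟩ ⟨B', hB', h3, h4⟩
      exact hno (.succ (base A' h1 h2)
        (ih (fun a ha b hb c hc => htri a (hB (hB' ha)) b (hB (hB' hb)) c (hB (hB' hc))) h4 h3)
        (hAB.mono hA' hB') (hA'.trans hA) (hB'.trans hB))

theorem packs_of_le_deg_add_deg (k : ℕ) {S : Finset V} (hcard : 3 * k ≤ S.card)
    (hσ : ∀ u ∈ S, ∀ v ∈ S, u ≠ v → ¬G.Adj u v → 6 * k - 1 ≤ deg G S u + deg G S v) :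
    Packs G S k := by
  induction k generalizing S with
  | zero => exact .zero S
  | succ k ih =>
  by_cases htri : ∃ a ∈ S, ∃ b ∈ S, ∃ c ∈ S, G.Adj a b ∧ G.Adj b c ∧ G.Adj c a
  · obtain ⟨a, ha, b, hb, c, hc, hab, hbc, hca⟩ := htri
    have hsub : ({a, b, c} : Finset V) ⊆ S := by simp [Finset.insert_subset_iff, *]
    have h3 : ({a, b, c} : Finset V).card = 3 :=
      Finset.card_eq_three.2 ⟨a, b, c, hab.ne, hca.ne', hbc.ne, rfl⟩
    refine .succ (A := {a, b, c}) (.of_triangle (by simp) (by simp) (by simp) hab hbc hca)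
      (ih (S := S \ {a, b, c}) ?_ fun u hu v hv huv hnuv => ?_) Finset.disjoint_sdiff hsub
      Finset.sdiff_subset
    · rw [Finset.card_sdiff_of_subset hsub]
      omega
    · have h1 := hσ u (Finset.sdiff_subset hu) v (Finset.sdiff_subset hv) huv hnuv
      have hle : ∀ w, deg G S w ≤ deg G (S \ {a, b, c}) w + 3 := fun w => by
        have := deg_le_deg_add_card_sdiff (G := G) S (S \ {a, b, c}) w
        rwa [Finset.sdiff_sdiff_eq_self hsub, h3] at this
      have h2 := hle u
      have h4 := hle v
      omega
  push Not at htri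
  have hadj : ∀ u ∈ S, ∀ v ∈ S, u ≠ v → deg G S u < 3 * (k + 1) → deg G S v < 3 * (k + 1) →
      G.Adj u v := by
    intro u hu v hv huv h1 h2
    by_contra hn
    have := hσ u hu v hv huv hn
    omega
  obtain ⟨x, y, hxy, hdeg⟩ : ∃ x y, (x = y ∨ G.Adj x y) ∧
      ∀ v ∈ S, v ∉ ({x, y} : Finset V) → 3 * (k + 1) ≤ deg G S v := by
    by_contra! hno
    obtain ⟨s, -⟩ : S.Nonempty := Finset.card_pos.1 (by omega)
    obtain ⟨x, hx, -, hdx⟩ := hno s s (.inl rfl)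
    obtain ⟨y, hy, hyx, hdy⟩ := hno x x (.inl rfl)
    have hxy : G.Adj x y := hadj x hx y hy (by rintro rfl; simp at hyx) hdx hdy
    obtain ⟨z, hz, hzxy, hdz⟩ := hno x y (.inr hxy)
    simp only [Finset.mem_insert, Finset.mem_singleton, not_or] at hzxy
    exact htri x hx y hy z hz hxy (hadj y hy z hz (Ne.symm hzxy.2) hdy hdz)
      (hadj z hz x hx hzxy.1 hdz hdx)
  refine packs_of_le_deg hxy k htri hdeg fun hsub => ?_
  have := (Finset.card_le_card hsub).trans Finset.card_le_two
  omega

theorem PathOn.exists_walk {S : Finset V} {u v : V} {n : ℕ} (h : PathOn G S u v n) :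
    ∃ p : G.Walk u v, p.IsPath ∧ p.length = n ∧ ∀ z ∈ p.support, z ∈ S := by
  induction h with
  | nil u => exact ⟨.nil, .nil, rfl, by simp⟩
  | cons huw hu _ ih =>
    obtain ⟨p, hp, hl, hs⟩ := ih
    refine ⟨.cons huw p, hp.cons fun h => hu (hs _ h), by simp [hl], ?_⟩
    simp only [SimpleGraph.Walk.support_cons, List.mem_cons, Finset.mem_insert]
    rintro z (rfl | hz)
    exacts [.inl rfl, .inr (hs z hz)]

theorem HasCycle.exists_walk {S : Finset V} (h : HasCycle G S) :
    ∃ (v : V) (p : G.Walk v v), p.IsCycle ∧ 3 ∣ p.length ∧ ∀ z ∈ p.support, z ∈ S := by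
  obtain ⟨S₀, hS₀, u, v, n, hp, hn, hvu, h3⟩ := h
  have hv := hp.right_mem
  obtain ⟨p, hpath, rfl, hs⟩ := hp.exists_walk
  refine ⟨v, .cons hvu p, (SimpleGraph.Walk.cons_isCycle_iff _ _).2 ⟨hpath, fun he => ?_⟩, by simpa,
    ?_⟩
  · cases p with
    | nil => simp at hn
    | cons huw q =>
      rw [SimpleGraph.Walk.cons_isPath_iff] at hpath
      rw [SimpleGraph.Walk.edges_cons, List.mem_cons] at he
      rcases he with he | he
      · rw [Sym2.eq_swap, Sym2.congr_right] at he
        subst he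
        have := SimpleGraph.Walk.length_eq_zero_iff.2 (SimpleGraph.Walk.isPath_iff_nil.1 hpath.1)
        simp [this] at hn
      · exact hpath.2 (q.snd_mem_support_of_mem_edges he)
  · simp only [SimpleGraph.Walk.support_cons, List.mem_cons]
    rintro z (rfl | hz)
    exacts [hS₀ hv, hS₀ (hs z hz)]

theorem deg_univ [Fintype V] [DecidableRel G.Adj] (v : V) : deg G Finset.univ v = G.degree v := by
  unfold deg
  rw [← SimpleGraph.card_neighborFinset_eq_degree]
  congr 1
  ext w
  simp

end ModThree

theorem stmt_14 {V : Type*} [Fintype V] [DecidableEq V]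
    (G : SimpleGraph V) [DecidableRel G.Adj] (k : ℕ) (hk : 1 ≤ k)
    (hcard : 3 * k ≤ Fintype.card V)
    (hσ : ∀ u v : V, u ≠ v → ¬G.Adj u v → 6 * k - 1 ≤ G.degree u + G.degree v) :
    ∃ W : Fin k → (v : V) × G.Walk v v,
      (∀ i, (W i).2.IsCycle ∧ 3 ∣ (W i).2.length) ∧
      (∀ i j, i ≠ j → ∀ x, x ∈ (W i).2.support → x ∉ (W j).2.support) := by
  obtain ⟨f, hf, hd⟩ := ModThree.packs_of_le_deg_add_deg (G := G) k (S := Finset.univ) hcard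
    fun u _ v _ huv hnuv => by simpa only [ModThree.deg_univ] using hσ u v huv hnuv
  choose v p hp h3 hs using fun i => (hf i).2.exists_walk
  exact ⟨fun i => ⟨v i, p i⟩, fun i => ⟨hp i, h3 i⟩, fun i j hij x hi hj =>
    Finset.disjoint_left.1 (hd i j hij) (hs i x hi) (hs j x hj)⟩
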